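/- arXiv:2207.12465 — 3 statements merged into one kernel-verified Lean document; each statement's English description precedes it below -/
import Mathlib

section
/- Every 2-connected graph on n vertices with minimum degree at least k+1 contains a cycle of length at least min(n, 2(k+1)). -/
def TwoConnected {V : Type*} [Fintype V] (G : SimpleGraph V) : Prop :=
  3 ≤ Fintype.card V ∧ G.Connected ∧
    ∀ v : V, ((⊤ : G.Subgraph).deleteVerts {v}).coe.Connected

section DiracHelpers
open SimpleGraph
variable {V : Type*} {G : SimpleGraph V}

theorem walk_sub (X Y : Set V) : ∀ (n : ℕ) (x y : V) (p : G.Walk x y), p.length ≤ n → x ∈ X → y ∈ Y →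
    ∃ (x' y' : V) (t : G.Walk x' y'), x' ∈ X ∧ y' ∈ Y ∧ (∀ z ∈ t.support, z ∈ p.support) ∧
      (∀ z ∈ t.support, z ∈ X → z = x') ∧ (∀ z ∈ t.support, z ∈ Y → z = y') := by
  classical
  intro n
  induction n with
  | zero =>
    intro x y p hp hx hy
    refine ⟨x, y, p, hx, hy, fun z hz => hz, ?_, ?_⟩
    · cases p with
      | nil => simp
      | cons h q => simp at hp
    · cases p with
      | nil => simp
      | cons h q => simp at hp
  | succ n ih =>
    intro x y p hp hx hy
    by_cases h1 : ∀ z ∈ p.support, z ∈ X → z = x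
    · by_cases h2 : ∀ z ∈ p.support, z ∈ Y → z = y
      · exact ⟨x, y, p, hx, hy, fun z hz => hz, h1, h2⟩
      · push Not at h2
        obtain ⟨z, hz, hzY, hne⟩ := h2
        have hl := Walk.length_takeUntil_lt_length hz hne
        obtain ⟨x', y', t, a1, a2, a3, a4⟩ := ih x z (p.takeUntil z hz) (by omega) hx hzY
        exact ⟨x', y', t, a1, a2, fun w hw => p.support_takeUntil_subset_support hz (a3 w hw), a4⟩
    · push Not at h1
      obtain ⟨z, hz, hzX, hne⟩ := h1
      have hl := congrArg Walk.length (p.take_spec hz)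
      rw [Walk.length_append] at hl
      have h0 : (p.takeUntil z hz).length ≠ 0 := by
        intro h0
        exact hne (Walk.eq_of_length_eq_zero h0).symm
      obtain ⟨x', y', t, a1, a2, a3, a4⟩ := ih z y (p.dropUntil z hz) (by omega) hzX hy
      exact ⟨x', y', t, a1, a2, fun w hw => p.support_dropUntil_subset_support hz (a3 w hw), a4⟩

theorem path_append {u v w : V} (p : G.Walk u v) (q : G.Walk v w) (hp : p.IsPath) (hq : q.IsPath)
    (h : ∀ z ∈ p.support, z ∈ q.support → z = v) : (p.append q).IsPath := by
  rw [Walk.isPath_def, Walk.support_append, List.nodup_append]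
  refine ⟨hp.support_nodup, hq.support_nodup.tail, ?_⟩
  intro z hz z' hz' e
  subst e
  have := h z hz (List.mem_of_mem_tail hz')
  subst this
  have h2 := hq.support_nodup
  rw [← Walk.cons_tail_support] at h2
  exact (List.nodup_cons.1 h2).1 hz'

theorem path_close {u v : V} (p : G.Walk u v) (hp : p.IsPath) (hl : 2 ≤ p.length) (h : G.Adj v u) :
    (Walk.cons h p).IsCycle := by
  rw [Walk.cons_isCycle_iff]
  refine ⟨hp, ?_⟩
  intro he
  cases p with
  | nil => simp at hl
  | cons h' q =>
    rw [Walk.edges_cons, List.mem_cons] at he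
    rw [Walk.cons_isPath_iff] at hp
    rcases he with he | he
    · simp at he
      rcases he with ⟨e1, e2⟩ | e
      · exact h.ne e1
      · subst e
        have := Walk.length_eq_zero_iff.2 (Walk.isPath_iff_nil.1 hp.1)
        simp [this] at hl
    · exact hp.2 (Walk.snd_mem_support_of_mem_edges _ he)

theorem two_paths_cycle {u v : V} (p q : G.Walk u v) (hp : p.IsPath) (hq : q.IsPath) (huv : u ≠ v)
    (hl : 2 ≤ p.length) (h : ∀ z ∈ p.support, z ∈ q.support → z = u ∨ z = v) :
    ∃ (x : V) (c : G.Walk x x), c.IsCycle ∧ p.length + 1 ≤ c.length := by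
  cases q with
  | nil => exact absurd rfl huv
  | cons h' q =>
    rw [Walk.cons_isPath_iff] at hq
    refine ⟨_, Walk.cons h'.symm (p.append q.reverse), path_close _ ?_ ?_ _, ?_⟩
    · refine path_append _ _ hp hq.1.reverse ?_
      intro z hz hz2
      rw [Walk.support_reverse, List.mem_reverse] at hz2
      rcases h z hz (by simp [hz2]) with e | e
      · subst e; exact absurd hz2 hq.2
      · exact e
    · simp; omega
    · simp

theorem card_le_path [DecidableEq V] {u v : V} (p : G.Walk u v) (s : Finset V)
    (h : ∀ z ∈ s, z ∈ p.support) : s.card ≤ p.length + 1 := by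
  rw [← Walk.length_support]
  exact (Finset.card_le_card (fun z hz => List.mem_toFinset.2 (h z hz))).trans (List.toFinset_card_le _)

theorem seg_exists (f : ℕ → V) (m : ℕ) (hf : ∀ i < m, G.Adj (f i) (f (i+1)))
    (hi : ∀ i ≤ m, ∀ j ≤ m, f i = f j → i = j) (i j : ℕ) (hij : i ≤ j) (hj : j ≤ m) :
    ∃ q : G.Walk (f i) (f j), q.IsPath ∧ q.length = j - i ∧
      ∀ z, z ∈ q.support ↔ ∃ t, i ≤ t ∧ t ≤ j ∧ f t = z := by
  induction j, hij using Nat.le_induction with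
  | base => 
    refine ⟨Walk.nil, by simp, by simp, ?_⟩
    intro z
    simp only [Walk.support_nil, List.mem_singleton]
    constructor
    · intro h; exact ⟨i, le_rfl, le_rfl, h.symm⟩
    · rintro ⟨t, h1, h2, h3⟩
      have : t = i := by omega
      subst this; exact h3.symm
  | succ j hij ih =>
    obtain ⟨q, h1, h2, h3⟩ := ih (by omega)
    refine ⟨q.concat (hf j (by omega)), ?_, by simp; omega, ?_⟩
    · rw [Walk.concat_isPath_iff]
      refine ⟨h1, ?_⟩
      rw [h3]
      rintro ⟨t, a, b, c⟩
      have := hi t (by omega) (j+1) hj c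
      omega
    · intro z
      rw [Walk.support_concat, List.mem_append, List.mem_singleton, h3]
      constructor
      · rintro (⟨t, a, b, c⟩ | e)
        · exact ⟨t, a, by omega, c⟩
        · exact ⟨j+1, by omega, le_rfl, e.symm⟩
      · rintro ⟨t, a, b, c⟩
        rcases Nat.lt_or_ge j t with h | h
        · have : t = j + 1 := by omega
          subst this; exact Or.inr c.symm
        · exact Or.inl ⟨t, a, h, c⟩

theorem take_drop_inter [DecidableEq V] {u v x : V} (p : G.Walk u v) (hp : p.IsPath) (hx : x ∈ p.support) :
    ∀ z ∈ (p.takeUntil x hx).support, z ∈ (p.dropUntil x hx).support → z = x := by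
  intro z h1 h2
  by_contra hne
  have h3 : ((p.takeUntil x hx).append (p.dropUntil x hx)).IsPath := by rwa [p.take_spec hx]
  exact h3.ne_of_mem_support_of_append hne h1 h2 rfl

/-- Two disjoint walks from `A` to `B`, using `a` and `b` as endpoints. -/
def Link (G : SimpleGraph V) (A B : Set V) (a b : V) : Prop :=
  ∃ (r s y1 y2 : V) (Q1 : G.Walk r y1) (Q2 : G.Walk s y2), r ∈ A ∧ s ∈ A ∧ y1 ∈ B ∧ y2 ∈ B ∧
    (r = a ∨ s = a) ∧ (y1 = b ∨ y2 = b) ∧ (∀ z ∈ Q1.support, z ∉ Q2.support) ∧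
    (∀ z ∈ Q1.support, z ∈ A → z = r) ∧ (∀ z ∈ Q2.support, z ∈ A → z = s) ∧
    (∀ z ∈ Q1.support, z ∈ B → z = y1) ∧ (∀ z ∈ Q2.support, z ∈ B → z = y2)

theorem link_aux (A B : Set V) (a b : V) (hb : b ∈ B)
    (hAB : ∀ z ∈ A, z ∈ B → z = a ∧ z = b)
    (hA : ∀ w, ∃ z ∈ A, z ≠ w) (hB : ∀ w, ∃ z ∈ B, z ≠ w)
    (hG : ∀ w x y, x ≠ w → y ≠ w → ∃ p : G.Walk x y, w ∉ p.support) :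
    ∀ (n : ℕ) (w : V) (W : G.Walk w b) (r s : V) (R : G.Walk r w) (S : G.Walk s w),
      W.length ≤ n → W.IsPath → R.IsPath → S.IsPath → r ∈ A → s ∈ A → (r = a ∨ s = a) →
      (∀ z ∈ W.support, z ∈ B → z = b) → (∀ z ∈ W.support, z ∈ A → z = w) →
      (∀ z ∈ R.support, z ∈ A → z = r) → (∀ z ∈ S.support, z ∈ A → z = s) →
      (∀ z ∈ R.support, z ∈ B → z = w) → (∀ z ∈ S.support, z ∈ B → z = w) →
      (∀ z ∈ R.support, z ∈ W.support → z = w) → (∀ z ∈ S.support, z ∈ W.support → z = w) →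
      (∀ z ∈ R.support, z ∈ S.support → z = w) → (w ∈ A → w = a) → Link G A B a b := by
  classical
  intro n
  induction n using Nat.strong_induction_on with
  | _ n ih =>
  intro w W r s R S hn hW hR hS hr hs hrs hWB hWA hRA hSA hRB hSB hRW hSW hRS hwa
  obtain ⟨x0, hx0, hx0w⟩ := hB w
  obtain ⟨y0, hy0, hy0w⟩ := hA w
  obtain ⟨p, hp⟩ := hG w x0 y0 hx0w hy0w
  obtain ⟨x, y, T, hx, hy, hTp, hTX, hTY⟩ :=
    walk_sub {z | z ≠ w ∧ (z ∈ B ∨ z ∈ W.support)} {z | z ≠ w ∧ (z ∈ A ∨ z ∈ R.support ∨ z ∈ S.support)}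
      p.length x0 y0 p le_rfl ⟨hx0w, Or.inl hx0⟩ ⟨hy0w, Or.inl hy0⟩
  clear hG hA hB hx0 hx0w hy0 hy0w
  have hTw : w ∉ T.support := fun h => hp (hTp w h)
  clear hTp hp p
  simp only [Set.mem_ofPred_eq] at hx hy hTX hTY
  have hTw' : ∀ z ∈ T.support, z ≠ w := fun z hz e => hTw (e ▸ hz)
  have hTB : ∀ z ∈ T.support, z ∈ B → z = x := fun z hz h => hTX z hz ⟨hTw' z hz, Or.inl h⟩
  have hTW : ∀ z ∈ T.support, z ∈ W.support → z = x := fun z hz h => hTX z hz ⟨hTw' z hz, Or.inr h⟩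
  have hTA : ∀ z ∈ T.support, z ∈ A → z = y := fun z hz h => hTY z hz ⟨hTw' z hz, Or.inl h⟩
  have hTR : ∀ z ∈ T.support, z ∈ R.support → z = y :=
    fun z hz h => hTY z hz ⟨hTw' z hz, Or.inr (Or.inl h)⟩
  have hTS : ∀ z ∈ T.support, z ∈ S.support → z = y :=
    fun z hz h => hTY z hz ⟨hTw' z hz, Or.inr (Or.inr h)⟩
  clear hTX hTY
  have hxT := T.start_mem_support
  have hyT := T.end_mem_support
  have hwW := W.start_mem_support
  have hbW := W.end_mem_support
  have hwR := R.end_mem_support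
  have hwS := S.end_mem_support
  have hwAB : w ∈ A → w ∈ B → w = b := fun h1 h2 => (hAB w h1 h2).2
  have key : ∀ (r s : V) (N : G.Walk r y) (O : G.Walk s w), r ∈ A → s ∈ A → (r = a ∨ s = a) →
      (∀ z ∈ N.support, z ≠ w ∧ z ∉ W.support ∧ z ∉ B ∧ z ∉ O.support ∧ (z ∈ A → z = r) ∧
        (z ∈ T.support → z = y)) →
      (∀ z ∈ O.support, (z ∈ A → z = s) ∧ (z ∈ B → z = w) ∧ (z ∈ W.support → z = w) ∧ 
        z ∉ T.support) → Link G A B a b := by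
    intro r s N O hr hs hrs hN hO
    by_cases hxW : x ∈ W.support
    · have hl := Walk.length_dropUntil_lt_length hxW hx.1
      have hsub := W.support_dropUntil_subset_support hxW
      have hsub' := W.support_takeUntil_subset_support hxW
      have htd := take_drop_inter W hW hxW
      have hwt : w ∉ (W.dropUntil x hxW).support := by
        intro h
        exact hx.1 (htd w (Walk.start_mem_support _) h).symm
      have m1 : ∀ z ∈ (N.append T.reverse).bypass.support, z ∈ N.support ∨ z ∈ T.support := by
        intro z hz
        have := Walk.support_bypass_subset_support _ hz
        rw [Walk.mem_support_append_iff] at this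
        simpa using this
      have m2 : ∀ z ∈ (O.append (W.takeUntil x hxW)).bypass.support, z ∈ O.support ∨ z ∈ (W.takeUntil x hxW).support := by
        intro z hz
        have := Walk.support_bypass_subset_support _ hz
        rw [Walk.mem_support_append_iff] at this
        simpa using this
      have hOs := O.start_mem_support
      have hNs := N.start_mem_support
      have hNe := N.end_mem_support
      have hOe := O.end_mem_support
      refine ih _ (lt_of_lt_of_le hl hn) x (W.dropUntil x hxW) r s (N.append T.reverse).bypass
        (O.append (W.takeUntil x hxW)).bypass le_rfl (hW.dropUntil _) (Walk.bypass_isPath _) (Walk.bypass_isPath _)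
        hr hs hrs ?_ ?_ ?_ ?_ ?_ ?_ ?_ ?_ ?_ ?_ <;> clear ih
      · intro z hz; exact hWB z (hsub hz)
      · intro z hz h; have := hWA z (hsub hz) h; subst this; exact absurd hz hwt
      · intro z hz h; rcases m1 z hz with h1 | h1 <;> grind
      · intro z hz h; rcases m2 z hz with h1 | h1 <;> grind
      · intro z hz h; rcases m1 z hz with h1 | h1 <;> grind
      · intro z hz h
        rcases m2 z hz with h1 | h1
        · have := (hO z h1).2.1 h
          subst this
          have := hWB z hwW h
          subst this
          exact absurd (Walk.end_mem_support _) hwt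
        · have := hWB z (hsub' h1) h
          subst this
          exact htd _ h1 (Walk.end_mem_support _)
      · intro z hz h; rcases m1 z hz with h1 | h1 <;> grind
      · intro z hz h; rcases m2 z hz with h1 | h1 <;> grind
      · intro z hz h; rcases m1 z hz with h1 | h1 <;> rcases m2 z h with h2 | h2 <;> grind
      · grind
    · have hxB : x ∈ B := by grind
      have m1 : ∀ z ∈ (N.append T.reverse).support, z ∈ N.support ∨ z ∈ T.support := by
        intro z hz
        rw [Walk.mem_support_append_iff] at hz
        simpa using hz
      have m2 : ∀ z ∈ (O.append W).support, z ∈ O.support ∨ z ∈ W.support := by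
        intro z hz
        rwa [Walk.mem_support_append_iff] at hz
      have hOs := O.start_mem_support
      have hNs := N.start_mem_support
      have hNe := N.end_mem_support
      have hOe := O.end_mem_support
      refine ⟨r, s, x, b, N.append T.reverse, O.append W, hr, hs, hxB, hb, hrs, Or.inr rfl, ?_, ?_, ?_, ?_, ?_⟩ <;> clear ih
      · intro z hz h; rcases m1 z hz with h1 | h1 <;> rcases m2 z h with h2 | h2 <;> grind
      · intro z hz h; rcases m1 z hz with h1 | h1 <;> grind
      · intro z hz h; rcases m2 z hz with h1 | h1 <;> grind
      · intro z hz h; rcases m1 z hz with h1 | h1 <;> grind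
      · intro z hz h; rcases m2 z hz with h1 | h1 <;> grind
  by_cases hyR : y ∈ R.support
  · have hs1 := R.support_takeUntil_subset_support hyR
    have hw1 := R.endpoint_notMem_support_takeUntil hR hyR hy.1.symm
    refine key r s (R.takeUntil y hyR) S hr hs hrs ?_ ?_ <;> clear ih key
    · intro z hz
      have := hs1 hz
      grind
    · grind
  by_cases hyS : y ∈ S.support
  · have hs1 := S.support_takeUntil_subset_support hyS
    have hw1 := S.endpoint_notMem_support_takeUntil hS hyS hy.1.symm
    refine key s r (S.takeUntil y hyS) R hs hr hrs.symm ?_ ?_ <;> clear ih key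
    · intro z hz
      have := hs1 hz
      grind
    · grind
  have hyA : y ∈ A := by grind
  have hyB : y ∉ B := by
    intro h
    have h1 := hAB y hyA h
    have := hRA
    rcases hrs with h | h
    · exact hyR (by rw [h1.1, ← h]; exact R.start_mem_support)
    · exact hyS (by rw [h1.1, ← h]; exact S.start_mem_support)
  rcases hrs with h | h
  · refine key y r Walk.nil R hyA hr (Or.inr h) ?_ ?_ <;> clear ih key
    · intro z hz
      rw [Walk.support_nil, List.mem_singleton] at hz
      subst hz
      grind
    · grind
  · refine key y s Walk.nil S hyA hs (Or.inr h) ?_ ?_ <;> clear ih key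
    · intro z hz
      rw [Walk.support_nil, List.mem_singleton] at hz
      subst hz
      grind
    · grind

theorem link_exists (A B : Set V) (a b : V) (ha : a ∈ A) (hb : b ∈ B)
    (hAB : ∀ z ∈ A, z ∈ B → z = a ∧ z = b)
    (hA : ∀ w, ∃ z ∈ A, z ≠ w) (hB : ∀ w, ∃ z ∈ B, z ≠ w)
    (hG : ∀ w x y, x ≠ w → y ≠ w → ∃ p : G.Walk x y, w ∉ p.support)
    (W : G.Walk a b) (hW : W.IsPath) (hWB : ∀ z ∈ W.support, z ∈ B → z = b)
    (hWA : ∀ z ∈ W.support, z ∈ A → z = a) : Link G A B a b := by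
  refine link_aux A B a b hb hAB hA hB hG W.length a W a a Walk.nil Walk.nil le_rfl hW (by simp) (by simp)
    ha ha (Or.inl rfl) hWB hWA ?_ ?_ ?_ ?_ ?_ ?_ ?_ ?_ <;> simp

/-- A path inside the initial segment of `f` covering the neighbours of `f 0`. -/
theorem side_path [Fintype V] [DecidableEq V] [DecidableRel G.Adj] (f : ℕ → V) (m : ℕ)
    (hf : ∀ i < m, G.Adj (f i) (f (i+1)))
    (hi : ∀ i ≤ m, ∀ j ≤ m, f i = f j → i = j) (p a : ℕ) (hpa : p < a) (ham : a ≤ m)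
    (hadj : G.Adj (f 0) (f a)) (hnb : ∀ z, G.Adj (f 0) z → ∃ t ≤ a, f t = z) :
    ∃ q : G.Walk (f p) (f a), q.IsPath ∧ G.degree (f 0) ≤ q.length ∧
      ∀ z ∈ q.support, ∃ t ≤ a, f t = z := by
  have hex : ∃ t, p < t ∧ G.Adj (f 0) (f t) := ⟨a, hpa, hadj⟩
  classical
  obtain ⟨h1, h2⟩ := Nat.find_spec hex
  have h3 : Nat.find hex ≤ a := Nat.find_min' hex ⟨hpa, hadj⟩
  have h4 : ∀ t, p < t → G.Adj (f 0) (f t) → Nat.find hex ≤ t := fun t x y => Nat.find_min' hex ⟨x, y⟩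
  generalize Nat.find hex = c at *
  obtain ⟨q1, a1, a2, a3⟩ := seg_exists f m hf hi 0 p (by omega) (by omega)
  obtain ⟨q2, b1, b2, b3⟩ := seg_exists f m hf hi c a (by omega) (by omega)
  have hsup : ∀ z, z ∈ (q1.reverse.append (Walk.cons h2 q2)).support ↔ z ∈ q1.support ∨ z ∈ q2.support := by
    intro z
    rw [Walk.mem_support_append_iff, Walk.support_cons, List.mem_cons, Walk.support_reverse, List.mem_reverse]
    have := q1.start_mem_support
    grind
  refine ⟨q1.reverse.append (Walk.cons h2 q2), ?_, ?_, ?_⟩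
  · refine path_append _ _ a1.reverse ?_ ?_
    · rw [Walk.cons_isPath_iff]
      refine ⟨b1, ?_⟩
      rw [b3]
      rintro ⟨t, x, y, z⟩
      have := hi t (by omega) 0 (by omega) z
      omega
    · intro z hz hz2
      rw [Walk.support_reverse, List.mem_reverse, a3] at hz
      rw [Walk.support_cons, List.mem_cons, b3] at hz2
      rcases hz2 with h | ⟨t, x, y, e⟩
      · exact h
      · obtain ⟨t', x', y', e'⟩ := hz
        have := hi t (by omega) t' (by omega) (e.trans e'.symm)
        omega
  · have := card_le_path (q1.reverse.append (Walk.cons h2 q2)) (insert (f 0) (G.neighborFinset (f 0))) ?_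
    · rw [Finset.card_insert_of_notMem (by simp), G.card_neighborFinset_eq_degree] at this
      omega
    · intro z hz
      rw [hsup, a3, b3]
      rw [Finset.mem_insert, mem_neighborFinset] at hz
      rcases hz with rfl | hz
      · exact Or.inl ⟨0, by omega, by omega, rfl⟩
      · obtain ⟨t, ht, rfl⟩ := hnb z hz
        by_cases h : t ≤ p
        · exact Or.inl ⟨t, by omega, h, rfl⟩
        · exact Or.inr ⟨t, h4 t (by omega) hz, ht, rfl⟩
  · intro z hz
    rw [hsup, a3, b3] at hz
    rcases hz with ⟨t, x, y, e⟩ | ⟨t, x, y, e⟩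
    · exact ⟨t, by omega, e⟩
    · exact ⟨t, by omega, e⟩

theorem side_path_rev [Fintype V] [DecidableEq V] [DecidableRel G.Adj] (f : ℕ → V) (m : ℕ)
    (hf : ∀ i < m, G.Adj (f i) (f (i+1)))
    (hi : ∀ i ≤ m, ∀ j ≤ m, f i = f j → i = j) (q b : ℕ) (hbq : b < q) (hqm : q ≤ m)
    (hadj : G.Adj (f m) (f b)) (hnb : ∀ z, G.Adj (f m) z → ∃ t, b ≤ t ∧ t ≤ m ∧ f t = z) :
    ∃ p : G.Walk (f q) (f b), p.IsPath ∧ G.degree (f m) ≤ p.length ∧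
      ∀ z ∈ p.support, ∃ t, b ≤ t ∧ t ≤ m ∧ f t = z := by
  have e1 : m - (m - q) = q := by omega
  have e2 : m - (m - b) = b := by omega
  have := side_path (G := G) (fun i => f (m - i)) m ?_ ?_ (m - q) (m - b) (by omega) (by omega) ?_ ?_
  · simp only [Nat.sub_zero] at this
    rw [e1, e2] at this
    obtain ⟨p, h1, h2, h3⟩ := this
    refine ⟨p, h1, h2, ?_⟩
    intro z hz
    obtain ⟨t, ht, e⟩ := h3 z hz
    exact ⟨m - t, by omega, by omega, e⟩
  · intro i h
    have := hf (m - (i + 1)) (by omega)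
    rw [show m - (i + 1) + 1 = m - i by omega] at this
    exact this.symm
  · intro i h j h' e
    have := hi _ (by omega) _ (by omega) e
    omega
  · simpa only [e2, Nat.sub_zero] using hadj
  · intro z hz
    obtain ⟨t, h1, h2, e⟩ := hnb z hz
    exact ⟨m - t, by omega, by simpa only [show m - (m - t) = t by omega] using e⟩

theorem case_B [Fintype V] [DecidableEq V] [DecidableRel G.Adj] (f : ℕ → V) (m d : ℕ) (hd : 2 ≤ d)
    (hdeg : ∀ v, d ≤ G.degree v)
    (hf : ∀ i < m, G.Adj (f i) (f (i+1)))
    (hi : ∀ i ≤ m, ∀ j ≤ m, f i = f j → i = j)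
    (hn0 : ∀ z, G.Adj (f 0) z → ∃ t ≤ m, f t = z)
    (hnm : ∀ z, G.Adj (f m) z → ∃ t ≤ m, f t = z)
    (hG : ∀ w x y, x ≠ w → y ≠ w → ∃ p : G.Walk x y, w ∉ p.support)
    (hno : ∀ i j, i < j → j ≤ m → G.Adj (f 0) (f j) → ¬ G.Adj (f m) (f i)) :
    ∃ (v : V) (c : G.Walk v v), c.IsCycle ∧ 2 * d ≤ c.length := by
  classical
  have hex : ∀ v : V, ∃ z, G.Adj v z := by
    intro v
    have : 0 < G.degree v := by have := hdeg v; omega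
    exact (G.degree_pos_iff_exists_adj v).1 this
  obtain ⟨a, ham, haadj, hamax⟩ : ∃ a ≤ m, G.Adj (f 0) (f a) ∧ ∀ t ≤ m, G.Adj (f 0) (f t) → t ≤ a := by
    obtain ⟨z, hz⟩ := hex (f 0)
    obtain ⟨t, ht, rfl⟩ := hn0 z hz
    refine ⟨Nat.findGreatest (fun t => G.Adj (f 0) (f t)) m, Nat.findGreatest_le _,
      Nat.findGreatest_spec (P := fun t => G.Adj (f 0) (f t)) ht hz, ?_⟩
    intro t' h h'
    exact Nat.le_findGreatest h h'
  obtain ⟨b, hbm, hbadj, hbmin⟩ : ∃ b ≤ m, G.Adj (f m) (f b) ∧ ∀ t, G.Adj (f m) (f t) → b ≤ t := by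
    obtain ⟨z, hz⟩ := hex (f m)
    obtain ⟨t, ht, rfl⟩ := hnm z hz
    have hx : ∃ t, G.Adj (f m) (f t) := ⟨t, hz⟩
    exact ⟨Nat.find hx, (Nat.find_min' hx hz).trans ht, Nat.find_spec hx, fun t h => Nat.find_min' hx h⟩
  have hab : a ≤ b := by
    by_contra h
    exact hno b a (by omega) ham haadj hbadj
  have ha0 : 0 < a := by
    rcases Nat.eq_zero_or_pos a with h | h
    · subst h; exact absurd haadj (G.irrefl)
    · exact h
  have hbm' : b < m := by
    rcases Nat.lt_or_ge b m with h | h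
    · exact h
    · have : b = m := by omega
      subst this; exact absurd hbadj (G.irrefl)
  obtain ⟨W, hW1, -, hW2⟩ := seg_exists f m hf hi a b hab hbm
  have hlink : Link G {z | ∃ t ≤ a, f t = z} {z | ∃ t, b ≤ t ∧ t ≤ m ∧ f t = z} (f a) (f b) := by
    refine link_exists _ _ _ _ ⟨a, le_rfl, rfl⟩ ⟨b, le_rfl, hbm, rfl⟩ ?_ ?_ ?_ hG W hW1 ?_ ?_
    · rintro z ⟨t, ht, rfl⟩ ⟨t', h1, h2, e⟩
      have := hi _ h2 _ (by omega) e
      have e1 : t = a := by omega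
      have e2 : t = b := by omega
      exact ⟨by rw [e1], by rw [← e2]⟩
    · intro w
      by_cases h : f 0 = w
      · refine ⟨f a, ⟨a, le_rfl, rfl⟩, ?_⟩
        rw [← h]; exact haadj.ne'
      · exact ⟨f 0, ⟨0, by omega, rfl⟩, h⟩
    · intro w
      by_cases h : f m = w
      · refine ⟨f b, ⟨b, le_rfl, hbm, rfl⟩, ?_⟩
        rw [← h]; exact hbadj.ne'
      · exact ⟨f m, ⟨m, by omega, le_rfl, rfl⟩, h⟩
    · rintro z hz ⟨t, h1, h2, rfl⟩
      obtain ⟨t', h3, h4, e⟩ := (hW2 _).1 hz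
      have := hi _ (by omega) _ h2 e
      rw [show t = b by omega]
    · rintro z hz ⟨t, h1, rfl⟩
      obtain ⟨t', h3, h4, e⟩ := (hW2 _).1 hz
      have := hi _ (by omega) _ (by omega) e
      rw [show t = a by omega]
  have fin : ∀ (s y1 y2 : V) (Q1 : G.Walk (f a) y1) (Q2 : G.Walk s y2), (∃ t ≤ a, f t = s) →
      (∃ t, b ≤ t ∧ t ≤ m ∧ f t = y1) → (∃ t, b ≤ t ∧ t ≤ m ∧ f t = y2) → 
      (y1 = f b ∨ y2 = f b) → (∀ z ∈ Q1.support, z ∉ Q2.support) → 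
      (∀ z ∈ Q1.support, (∃ t ≤ a, f t = z) → z = f a) → (∀ z ∈ Q2.support, (∃ t ≤ a, f t = z) → z = s) →
      (∀ z ∈ Q1.support, (∃ t, b ≤ t ∧ t ≤ m ∧ f t = z) → z = y1) →
      (∀ z ∈ Q2.support, (∃ t, b ≤ t ∧ t ≤ m ∧ f t = z) → z = y2) →
      ∃ (v : V) (c : G.Walk v v), c.IsCycle ∧ 2 * d ≤ c.length := by
    intro s y1 y2 Q1 Q2 hs hy1 hy2 hyb hdis hQ1A hQ2A hQ1B hQ2B
    obtain ⟨L, hL1, hL2, hL3⟩ : ∃ L : G.Walk y1 y2, L.IsPath ∧ d ≤ L.length ∧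
        ∀ z ∈ L.support, ∃ t, b ≤ t ∧ t ≤ m ∧ f t = z := by
      have hne : y1 ≠ y2 := by
        intro e
        exact hdis _ Q1.end_mem_support (e ▸ Q2.end_mem_support)
      have hnb : ∀ z, G.Adj (f m) z → ∃ t, b ≤ t ∧ t ≤ m ∧ f t = z := by
        intro z hz
        obtain ⟨t, ht, rfl⟩ := hnm z hz
        exact ⟨t, hbmin t hz, ht, rfl⟩
      rcases hyb with rfl | rfl
      · obtain ⟨q, h1, h2, rfl⟩ := hy2
        have hbq : b < q := by
          rcases Nat.lt_or_ge b q with h | h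
          · exact h
          · exact absurd (by rw [show b = q by omega]) hne
        obtain ⟨p, p1, p2, p3⟩ := side_path_rev f m hf hi q b hbq h2 hbadj hnb
        refine ⟨p.reverse, p1.reverse, ?_, ?_⟩
        · rw [Walk.length_reverse]; exact (hdeg _).trans p2
        · intro z hz
          rw [Walk.support_reverse, List.mem_reverse] at hz
          exact p3 z hz
      · obtain ⟨q, h1, h2, rfl⟩ := hy1
        have hbq : b < q := by
          rcases Nat.lt_or_ge b q with h | h
          · exact h
          · exact absurd (by rw [show b = q by omega]) hne
        obtain ⟨p, p1, p2, p3⟩ := side_path_rev f m hf hi q b hbq h2 hbadj hnb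
        exact ⟨p, p1, (hdeg _).trans p2, p3⟩
    obtain ⟨p, hpa, rfl⟩ := hs
    have hpa' : p < a := by
      rcases Nat.lt_or_ge p a with h | h
      · exact h
      · have e : a = p := by omega
        subst e
        exact absurd Q2.start_mem_support (hdis _ Q1.start_mem_support)
    obtain ⟨K, hK1, hK2, hK3⟩ := side_path f m hf hi p a hpa' ham haadj (by
      intro z hz
      obtain ⟨t, ht, rfl⟩ := hn0 z hz
      exact ⟨t, hamax t ht hz, rfl⟩)
    have hK2' := (hdeg (f 0)).trans hK2
    have hAB : ∀ z, (∃ t ≤ a, f t = z) → (∃ t, b ≤ t ∧ t ≤ m ∧ f t = z) → z = f a := by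
      rintro z ⟨t, ht, rfl⟩ ⟨t', h1, h2, e⟩
      have := hi _ h2 _ (by omega) e
      rw [show t = a by omega]
    have s1 : ∀ z ∈ Q1.bypass.support, z ∈ Q1.support := fun z hz => Q1.support_bypass_subset_support hz
    have s2 : ∀ z ∈ Q2.bypass.support, z ∈ Q2.support := fun z hz => Q2.support_bypass_subset_support hz
    have p1 : (K.append Q1.bypass).IsPath :=
      path_append _ _ hK1 Q1.bypass_isPath (fun z h1 h2 => hQ1A z (s1 z h2) (hK3 z h1))
    have p2 : ((K.append Q1.bypass).append L).IsPath := by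
      refine path_append _ _ p1 hL1 ?_
      intro z h1 h2
      rw [Walk.mem_support_append_iff] at h1
      have hzB := hL3 z h2
      rcases h1 with h1 | h1
      · have := hAB z (hK3 z h1) hzB
        exact hQ1B z (this ▸ Q1.start_mem_support) hzB
      · exact hQ1B z (s1 z h1) hzB
    have hne : f p ≠ y2 := by
      obtain ⟨q, h1, h2, rfl⟩ := hy2
      intro e
      have := hi _ (by omega) _ h2 e
      omega
    have hlen : 2 * d ≤ ((K.append Q1.bypass).append L).length := by
      rw [Walk.length_append, Walk.length_append]
      omega
    obtain ⟨v, c, hc, hl⟩ := two_paths_cycle _ _ p2 Q2.bypass_isPath hne (by omega) (by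
      intro z h1 h2
      have h2' := s2 z h2
      rw [Walk.mem_support_append_iff, Walk.mem_support_append_iff] at h1
      rcases h1 with (h1 | h1) | h1
      · exact Or.inl (hQ2A z h2' (hK3 z h1))
      · exact absurd h2' (hdis z (s1 z h1))
      · exact Or.inr (hQ2B z h2' (hL3 z h1)))
    exact ⟨v, c, hc, by omega⟩
  obtain ⟨r, s, y1, y2, Q1, Q2, hr, hs, hy1, hy2, hrs, hyb, hdis, h1, h2, h3, h4⟩ := hlink
  rcases hrs with rfl | rfl
  · exact fin s y1 y2 Q1 Q2 hs hy1 hy2 hyb hdis h1 h2 h3 h4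
  · exact fin r y2 y1 Q2 Q1 hr hy2 hy1 hyb.symm (fun z hz hz' => hdis z hz' hz) h2 h1 h4 h3

theorem case_A [Fintype V] [DecidableEq V] [DecidableRel G.Adj] (f : ℕ → V) (m d : ℕ) (hd : 2 ≤ d)
    (hdeg : ∀ v, d ≤ G.degree v) (hconn : G.Connected)
    (hf : ∀ i < m, G.Adj (f i) (f (i+1)))
    (hi : ∀ i ≤ m, ∀ j ≤ m, f i = f j → i = j)
    (hn0 : ∀ z, G.Adj (f 0) z → ∃ t ≤ m, f t = z)
    (hnm : ∀ z, G.Adj (f m) z → ∃ t ≤ m, f t = z)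
    (hmax : ∀ (u v : V) (p : G.Walk u v), p.IsPath → p.length ≤ m)
    (hyes : ∃ i j, i < j ∧ j ≤ m ∧ G.Adj (f 0) (f j) ∧ G.Adj (f m) (f i)) :
    ∃ (v : V) (c : G.Walk v v), c.IsCycle ∧ min (Fintype.card V) (2 * d) ≤ c.length := by
  classical
  have hex : ∃ g, ∃ i, 0 < g ∧ i + g ≤ m ∧ G.Adj (f 0) (f (i + g)) ∧ G.Adj (f m) (f i) := by
    obtain ⟨i, j, h1, h2, h3, h4⟩ := hyes
    exact ⟨j - i, i, by omega, by omega, by rwa [show i + (j - i) = j by omega], h4⟩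
  have hmin : ∀ g', g' < Nat.find hex → ∀ i, 0 < g' → i + g' ≤ m → G.Adj (f 0) (f (i + g')) →
      ¬ G.Adj (f m) (f i) := by
    intro g' hg' i h1 h2 h3 h4
    exact Nat.find_min hex hg' ⟨i, h1, h2, h3, h4⟩
  obtain ⟨i, hg0, him, h0, h1⟩ := Nat.find_spec hex
  generalize Nat.find hex = g at *
  have cS : d ≤ ((Finset.range m).filter (fun t => G.Adj (f 0) (f (t+1)))).card := by
    refine (hdeg (f 0)).trans ?_
    rw [← G.card_neighborFinset_eq_degree]
    refine le_trans (Finset.card_le_card ?_) (Finset.card_image_le (f := fun t => f (t + 1)))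
    intro z hz
    rw [mem_neighborFinset] at hz
    obtain ⟨t, ht, rfl⟩ := hn0 z hz
    have ht0 : t ≠ 0 := by rintro rfl; exact G.irrefl hz
    rw [Finset.mem_image]
    have e : t - 1 + 1 = t := by omega
    exact ⟨t - 1, by rw [Finset.mem_filter, Finset.mem_range, e]; exact ⟨by omega, hz⟩, by rw [e]⟩
  have cT : d ≤ ((Finset.range m).filter (fun t => G.Adj (f m) (f t))).card := by
    refine (hdeg (f m)).trans ?_
    rw [← G.card_neighborFinset_eq_degree]
    refine le_trans (Finset.card_le_card ?_) (Finset.card_image_le (f := f))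
    intro z hz
    rw [mem_neighborFinset] at hz
    obtain ⟨t, ht, rfl⟩ := hnm z hz
    have ht0 : t ≠ m := by rintro rfl; exact G.irrefl hz
    rw [Finset.mem_image]
    exact ⟨t, by rw [Finset.mem_filter, Finset.mem_range]; exact ⟨by omega, hz⟩, rfl⟩
  have hm2 : d ≤ m := cS.trans ((Finset.card_filter_le _ _).trans (by simp))
  obtain ⟨q1, a1, a2, a3⟩ := seg_exists f m hf hi 0 i (by omega) (by omega)
  obtain ⟨q2, b1, b2, b3⟩ := seg_exists f m hf hi (i + g) m (by omega) (by omega)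
  have hp : (q1.append (Walk.cons h1.symm q2.reverse)).IsPath := by
    refine path_append _ _ a1 ?_ ?_
    · rw [Walk.cons_isPath_iff]
      refine ⟨b1.reverse, ?_⟩
      rw [Walk.support_reverse, List.mem_reverse, b3]
      rintro ⟨t, x, y, z⟩
      have := hi t (by omega) i (by omega) z
      omega
    · intro z hz hz2
      rw [a3] at hz
      rw [Walk.support_cons, List.mem_cons, Walk.support_reverse, List.mem_reverse, b3] at hz2
      rcases hz2 with h | ⟨t, x, y, e⟩
      · exact h
      · obtain ⟨t', x', y', e'⟩ := hz
        have := hi t (by omega) t' (by omega) (e.trans e'.symm)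
        omega
  have hlen : (q1.append (Walk.cons h1.symm q2.reverse)).length = i + 1 + (m - (i + g)) := by
    rw [Walk.length_append, Walk.length_cons, Walk.length_reverse]; omega
  generalize hP : q1.append (Walk.cons h1.symm q2.reverse) = P at hp hlen
  by_cases hg1 : g = 1
  · subst hg1
    have hc := path_close P hp (by omega) h0.symm
    have hcl : (Walk.cons h0.symm P).length = m + 1 := by rw [Walk.length_cons]; omega
    generalize Walk.cons h0.symm P = c at hc hcl
    refine ⟨_, c, hc, ?_⟩
    by_cases hall : ∀ y, y ∈ P.support
    · have := card_le_path P Finset.univ (fun z _ => hall z)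
      rw [Finset.card_univ] at this
      exact (min_le_left _ _).trans (by omega)
    by_cases hall : ∀ y, y ∈ c.support
    · have h1 : Fintype.card V ≤ c.support.tail.toFinset.card := by
        rw [← Finset.card_univ]
        refine Finset.card_le_card ?_
        intro z _
        rw [List.mem_toFinset]
        have := hall z
        rw [← Walk.cons_tail_support, List.mem_cons] at this
        rcases this with rfl | h
        · exact Walk.end_mem_tail_support hc.not_nil
        · exact h
      have h2 := List.toFinset_card_le c.support.tail
      have h3 := c.length_support
      rw [List.length_tail] at h2
      exact (min_le_left _ _).trans (by omega)
    · exfalso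
      push Not at hall
      obtain ⟨y, hy⟩ := hall
      obtain ⟨w⟩ := hconn.preconnected (f (i+1)) y
      obtain ⟨e, -, he1, he2⟩ := w.exists_boundary_dart {z | z ∈ c.support} c.start_mem_support hy
      have hx : e.fst ∈ c.support := he1
      have hy : e.snd ∉ c.support := he2
      have hc' := hc.rotate hx
      have hpt := hc'.isPath_tail
      have hl : (c.rotate e.fst hx).tail.length + 1 = m + 1 := by
        rw [Walk.length_tail_add_one hc'.not_nil, Walk.length_rotate, hcl]
      have := hmax _ _ _ (hpt.concat (w := e.snd) (by
        intro h
        have h' : e.snd ∈ (c.rotate e.fst hx).support := by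
          rw [← Walk.cons_tail_support, ← Walk.support_tail_of_not_nil _ hc'.not_nil]
          exact List.mem_cons_of_mem _ h
        rw [Walk.mem_support_rotate_iff] at h'
        exact hy h') e.adj)
      rw [Walk.length_concat] at this
      omega
  · have hcnt : 2 * d + (g - 2) ≤ m := by
      have hd1 : Disjoint ((Finset.range m).filter (fun t => G.Adj (f 0) (f (t+1))))
          ((Finset.range m).filter (fun t => G.Adj (f m) (f t))) := by
        rw [Finset.disjoint_left]
        intro t ht ht'
        simp only [Finset.mem_filter, Finset.mem_range] at ht ht'
        exact hmin 1 (by omega) t (by omega) (by omega) ht.2 ht'.2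
      have hd2 : Disjoint (((Finset.range m).filter (fun t => G.Adj (f 0) (f (t+1)))) ∪ 
          ((Finset.range m).filter (fun t => G.Adj (f m) (f t)))) (Finset.Ico (i+1) (i+g-1)) := by
        rw [Finset.disjoint_left]
        intro t ht ht'
        simp only [Finset.mem_union, Finset.mem_filter, Finset.mem_range, Finset.mem_Ico] at ht ht'
        rcases ht with ht | ht
        · exact hmin (t + 1 - i) (by omega) i (by omega) (by omega)
            (by rw [show i + (t + 1 - i) = t + 1 by omega]; exact ht.2) h1
        · exact hmin (i + g - t) (by omega) t (by omega) (by omega)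
            (by rw [show t + (i + g - t) = i + g by omega]; exact h0) ht.2
      have hsub : (((Finset.range m).filter (fun t => G.Adj (f 0) (f (t+1)))) ∪ 
          ((Finset.range m).filter (fun t => G.Adj (f m) (f t)))) ∪ (Finset.Ico (i+1) (i+g-1)) ⊆ Finset.range m := by
        intro t ht
        simp only [Finset.mem_union, Finset.mem_filter, Finset.mem_range, Finset.mem_Ico] at ht ⊢
        omega
      have := Finset.card_le_card hsub
      rw [Finset.card_union_of_disjoint hd2, Finset.card_union_of_disjoint hd1, Finset.card_range,
        Nat.card_Ico] at this
      omega
    refine ⟨_, Walk.cons h0.symm P, path_close P hp (by omega) h0.symm, ?_⟩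
    rw [Walk.length_cons]
    exact (min_le_right _ _).trans (by omega)

theorem dirac_core [Fintype V] [DecidableEq V] [DecidableRel G.Adj] (d : ℕ) (hd : 2 ≤ d)
    (hdeg : ∀ v, d ≤ G.degree v) (hconn : G.Connected)
    (hG : ∀ w x y, x ≠ w → y ≠ w → ∃ p : G.Walk x y, w ∉ p.support) :
    ∃ (v : V) (c : G.Walk v v), c.IsCycle ∧ min (Fintype.card V) (2 * d) ≤ c.length := by
  classical
  obtain ⟨u, v, P, hP, hmax⟩ : ∃ (u v : V) (P : G.Walk u v), P.IsPath ∧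
      ∀ (u' v' : V) (p : G.Walk u' v'), p.IsPath → p.length ≤ P.length := by
    obtain ⟨v0⟩ := hconn.nonempty
    have hne : ({l | ∃ (u v : V) (P : G.Walk u v), P.IsPath ∧ P.length = l} : Set ℕ).Nonempty :=
      ⟨0, v0, v0, Walk.nil, by simp, rfl⟩
    have hbd : BddAbove ({l | ∃ (u v : V) (P : G.Walk u v), P.IsPath ∧ P.length = l} : Set ℕ) := by
      refine ⟨Fintype.card V, ?_⟩
      rintro l ⟨u, v, P, hP, rfl⟩
      exact hP.length_lt.le
    obtain ⟨u, v, P, hP, hl⟩ := Nat.sSup_mem hne hbd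
    refine ⟨u, v, P, hP, ?_⟩
    intro u' v' p hp
    rw [hl]
    exact le_csSup hbd ⟨u', v', p, hp, rfl⟩
  have hf : ∀ i < P.length, G.Adj (P.getVert i) (P.getVert (i+1)) := fun i h => P.adj_getVert_succ h
  have hi : ∀ i ≤ P.length, ∀ j ≤ P.length, P.getVert i = P.getVert j → i = j :=
    fun i h j h' e => hP.getVert_injOn h h' e
  have hn0 : ∀ z, G.Adj (P.getVert 0) z → ∃ t ≤ P.length, P.getVert t = z := by
    intro z hz
    rw [Walk.getVert_zero] at hz
    by_contra hcon
    have hzn : z ∉ P.support := by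
      intro h
      rw [Walk.mem_support_iff_exists_getVert] at h
      obtain ⟨t, h1, h2⟩ := h
      exact hcon ⟨t, h2, h1⟩
    have := hmax _ _ _ (hP.cons (h := hz.symm) hzn)
    rw [Walk.length_cons] at this
    omega
  have hnm : ∀ z, G.Adj (P.getVert P.length) z → ∃ t ≤ P.length, P.getVert t = z := by
    intro z hz
    rw [Walk.getVert_length] at hz
    by_contra hcon
    have hzn : z ∉ P.support := by
      intro h
      rw [Walk.mem_support_iff_exists_getVert] at h
      obtain ⟨t, h1, h2⟩ := h
      exact hcon ⟨t, h2, h1⟩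
    have := hmax _ _ _ (hP.concat hzn hz)
    rw [Walk.length_concat] at this
    omega
  by_cases hyes : ∃ i j, i < j ∧ j ≤ P.length ∧ G.Adj (P.getVert 0) (P.getVert j) ∧
      G.Adj (P.getVert P.length) (P.getVert i)
  · exact case_A P.getVert P.length d hd hdeg hconn hf hi hn0 hnm hmax hyes
  · obtain ⟨v, c, hc, hl⟩ := case_B P.getVert P.length d hd hdeg hf hi hn0 hnm hG
      (fun i j h1 h2 h3 h4 => hyes ⟨i, j, h1, h2, h3, h4⟩)
    exact ⟨v, c, hc, (min_le_right _ _).trans hl⟩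

theorem avoid_walk (w : V) (h : ((⊤ : G.Subgraph).deleteVerts {w}).coe.Connected) (x y : V)
    (hx : x ≠ w) (hy : y ≠ w) : ∃ p : G.Walk x y, w ∉ p.support := by
  obtain ⟨p⟩ := h.preconnected ⟨x, by simp [hx]⟩ ⟨y, by simp [hy]⟩
  refine ⟨p.map (Subgraph.hom _), ?_⟩
  intro hw
  have h2 : w ∈ p.support.map (Subgraph.hom _) := by
    rw [← Walk.support_map]; exact hw
  obtain ⟨z, hz, e⟩ := List.mem_map.1 h2
  have h3 : (z : V) ∈ (⊤ : G.Subgraph).verts \ {w} := z.2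
  exact h3.2 e

end DiracHelpers

/-- Dirac 1952: every 2-connected `n`-vertex graph with minimum degree at least `k+1`
contains a cycle of length at least `min n (2*(k+1))`. -/
theorem dirac_circumference {V : Type*} [Fintype V] [DecidableEq V]
    (G : SimpleGraph V) [DecidableRel G.Adj] (n k : ℕ)
    (hn : Fintype.card V = n)
    (h2 : TwoConnected G)
    (hmin : ∀ v : V, k + 1 ≤ G.degree v) :
    ∃ (v : V) (c : G.Walk v v), c.IsCycle ∧ min n (2 * (k + 1)) ≤ c.length := by
  obtain ⟨h3, hconn, hdel⟩ := h2
  have hG : ∀ w x y, x ≠ w → y ≠ w → ∃ p : G.Walk x y, w ∉ p.support :=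
    fun w x y hx hy => avoid_walk w (hdel w) x y hx hy
  have hdeg2 : ∀ v : V, 2 ≤ G.degree v := by
    intro v
    have hpos : 0 < G.degree v := by have := hmin v; omega
    obtain ⟨u, hu⟩ := (G.degree_pos_iff_exists_adj v).1 hpos
    obtain ⟨w, hw⟩ : ∃ w, w ∉ ({v, u} : Finset V) := by
      by_contra hcon
      push Not at hcon
      have h4 : Fintype.card V ≤ ({v, u} : Finset V).card := by
        rw [← Finset.card_univ]
        exact Finset.card_le_card (fun z _ => hcon z)
      have h5 : ({v, u} : Finset V).card ≤ 2 := Finset.card_le_two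
      omega
    simp only [Finset.mem_insert, Finset.mem_singleton, not_or] at hw
    obtain ⟨p, hp⟩ := hG u v w hu.ne hw.2
    cases p with
    | nil => exact absurd rfl hw.1
    | @cons _ z _ h q =>
      have hzu : z ≠ u := by
        rintro rfl
        apply hp
        rw [SimpleGraph.Walk.support_cons]
        exact List.mem_cons_of_mem _ q.start_mem_support
      rw [← G.card_neighborFinset_eq_degree, ← Finset.card_pair hzu]
      refine Finset.card_le_card ?_
      intro t ht
      rw [SimpleGraph.mem_neighborFinset]
      rw [Finset.mem_insert, Finset.mem_singleton] at ht
      rcases ht with rfl | rfl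
      · exact h
      · exact hu
  obtain ⟨v, c, hc, hl⟩ := dirac_core (G := G) (max (k + 1) 2) (le_max_right _ _)
    (fun v => max_le (hmin v) (hdeg2 v)) hconn hG
  refine ⟨v, c, hc, ?_⟩
  have := le_max_left (k + 1) 2
  omega
end

section
/- Let G be a 2-connected graph on n vertices with minimum degree exactly k and circumference c(G) with n ≥ c(G)+1. Then c(G) ≥ 2k. -/
inductive HP {V : Type*} [DecidableEq V] (G : SimpleGraph V) : V → V → Finset V → Prop
  | nil (x : V) : HP G x x {x}
  | cons {x y z : V} {S : Finset V} : G.Adj x y → HP G y z S → x ∉ S → HP G x z (insert x S)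

section
variable {V : Type*} [DecidableEq V] {G : SimpleGraph V}

theorem HP.left_mem {x y : V} {S : Finset V} (h : HP G x y S) : x ∈ S := by
  cases h <;> simp

theorem HP.right_mem {x y : V} {S : Finset V} (h : HP G x y S) : y ∈ S := by
  induction h with
  | nil => simp
  | cons _ _ _ ih => simp [ih]

/-- Join two disjoint paths by an edge. -/
theorem HP.join {x y z w : V} {S T : Finset V} (h : HP G x y S) (ha : G.Adj y z)
    (h' : HP G z w T) (hd : ∀ v ∈ S, v ∉ T) : HP G x w (S ∪ T) := by
  induction h with
  | nil x =>
    have := HP.cons ha h' (hd x (by simp))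
    rwa [Finset.singleton_union]
  | cons hxy _ hn ih =>
    rw [Finset.insert_union]
    refine HP.cons hxy (ih ha (fun v hv => hd v (by simp [hv]))) ?_
    have := hd _ (Finset.mem_insert_self _ _)
    simp [hn, this]

theorem HP.symm {x y : V} {S : Finset V} (h : HP G x y S) : HP G y x S := by
  induction h with
  | nil x => exact HP.nil x
  | @cons x y z S hxy _ hn ih =>
    have := ih.join hxy.symm (HP.nil x) (by grind)
    have e : S ∪ {x} = insert x S := by grind
    rwa [e] at this

/-- Split a path just before an interior (non-first) vertex. -/
theorem HP.split {x y z : V} {S : Finset V} (h : HP G x y S) (hz : z ∈ S) (hzx : z ≠ x) :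
    ∃ u S1 S2, HP G x u S1 ∧ G.Adj u z ∧ HP G z y S2 ∧ (∀ v ∈ S1, v ∉ S2) ∧ S = S1 ∪ S2 := by
  induction h with
  | nil x => simp at hz; exact absurd hz hzx
  | @cons x y w S hxy h hn ih =>
    have hzS : z ∈ S := by grind
    by_cases hzy : z = y
    · subst hzy
      exact ⟨x, {x}, S, HP.nil x, hxy, h, by grind, by grind⟩
    · obtain ⟨u, S1, S2, h1, h2, h3, h4, h5⟩ := ih hzS hzy
      refine ⟨u, insert x S1, S2, HP.cons hxy h1 (by grind), h2, h3, by grind, by grind⟩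

/-- Split a path at a vertex. -/
theorem HP.split_at {x y z : V} {S : Finset V} (h : HP G x y S) (hz : z ∈ S) :
    ∃ S1 S2, HP G x z S1 ∧ HP G z y S2 ∧ (∀ v ∈ S1, v ∈ S2 → v = z) ∧ S = S1 ∪ S2 := by
  by_cases hzx : z = x
  · subst hzx
    exact ⟨{z}, S, HP.nil z, h, by grind, by grind⟩
  · obtain ⟨u, S1, S2, h1, h2, h3, h4, h5⟩ := h.split hz hzx
    refine ⟨S1 ∪ {z}, S2, h1.join h2 (HP.nil z) ?_, h3, by grind, ?_⟩
    · have := h3.left_mem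
      grind
    · have := h3.left_mem
      grind

theorem HP.self {x y : V} {S : Finset V} (h : HP G x y S) (e : x = y) : S = {x} := by
  cases h with
  | nil => rfl
  | cons _ h' hn => subst e; exact absurd h'.right_mem hn

/-- Glue two paths at a common end vertex. -/
theorem HP.glue {x y z : V} {S T : Finset V} (h : HP G x y S) (h' : HP G y z T)
    (hd : ∀ v ∈ S, v ∈ T → v = y) : HP G x z (S ∪ T) := by
  induction h with
  | nil x =>
    have := h'.left_mem
    rwa [show ({x} : Finset V) ∪ T = T by grind]
  | @cons x y w S hxy h hn ih =>
    rw [Finset.insert_union]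
    have hw := h.right_mem
    exact HP.cons hxy (ih h' (by grind)) (by grind)

theorem HP.toWalk {x y : V} {S : Finset V} (h : HP G x y S) :
    ∃ p : G.Walk x y, p.IsPath ∧ p.support.toFinset = S := by
  induction h with
  | nil x => exact ⟨SimpleGraph.Walk.nil, by simp, by simp⟩
  | cons hxy _ hn ih =>
    obtain ⟨p, hp, e⟩ := ih
    refine ⟨SimpleGraph.Walk.cons hxy p, ?_, by simp [e]⟩
    rw [SimpleGraph.Walk.cons_isPath_iff]
    refine ⟨hp, ?_⟩
    rw [← e] at hn
    simpa using hn

theorem HP.ofWalk {x y : V} (p : G.Walk x y) (hp : p.IsPath) : HP G x y p.support.toFinset := by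
  induction p with
  | nil => simpa using HP.nil _
  | cons h p ih =>
    rw [SimpleGraph.Walk.cons_isPath_iff] at hp
    rw [SimpleGraph.Walk.support_cons, List.toFinset_cons]
    exact HP.cons h (ih hp.1) (by simpa using hp.2)

/-- Closing a path into a cycle. -/
theorem HP.cycle {x y : V} {S : Finset V} (h : HP G x y S) (ha : G.Adj x y) (h3 : 3 ≤ S.card)
    {c : ℕ} (hmax : ∀ (v : V) (w : G.Walk v v), w.IsCycle → w.length ≤ c) : S.card ≤ c := by
  obtain ⟨p, hp, e⟩ := h.toWalk
  have hl : S.card = p.length + 1 := by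
    rw [← e, List.toFinset_card_of_nodup hp.support_nodup, SimpleGraph.Walk.length_support]
  have hc : (SimpleGraph.Walk.cons ha.symm p).IsCycle := by
    rw [SimpleGraph.Walk.cons_isCycle_iff]
    refine ⟨hp, fun hmem => ?_⟩
    have : p.length = 1 := by
      rw [Sym2.eq_swap] at hmem
      exact hp.length_eq_one_of_mem_edges hmem
    omega
  have := hmax _ _ hc
  simp at this
  omega

/-- Two internally disjoint paths make a cycle. -/
theorem HP.cycle2 {x y : V} {S T : Finset V} (h : HP G x y S) (h' : HP G x y T)
    (hd : ∀ v ∈ S, v ∈ T → v = x ∨ v = y) (hxy : x ≠ y) (hT : ∃ z ∈ T, z ≠ x ∧ z ≠ y)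
    {c : ℕ} (hmax : ∀ (v : V) (w : G.Walk v v), w.IsCycle → w.length ≤ c) : (S ∪ T).card ≤ c := by
  obtain ⟨z, hzT, hzx, hzy⟩ := hT
  obtain ⟨u, T1, T2, h1, h2, h3, h4, h5⟩ := h'.split h'.right_mem hxy.symm
  have hT2 := h3.self rfl
  obtain ⟨u', T3, T4, g1, g2, g3, g4, g5⟩ := h1.symm.split h1.left_mem
    (by intro e; have := h1.self e; grind)
  have hT4 := g3.self rfl
  have hx := h.left_mem
  have hy := h.right_mem
  have := (h.join h2.symm g1 (by grind))
  have e : S ∪ T = S ∪ T3 := by grind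
  rw [e]
  refine this.cycle g2.symm ?_ hmax
  have : ({x, y, z} : Finset V) ⊆ S ∪ T3 := by grind
  have := Finset.card_le_card this
  rw [Finset.card_eq_three.2 ⟨x, y, z, hxy, hzx.symm, hzy.symm, rfl⟩] at this
  exact this

/-- minimal connecting path -/
theorem firstHit (v : V)
    (hcon : ∀ x y, x ≠ v → y ≠ v → ∃ S, HP G x y S ∧ v ∉ S) (X Y : Finset V)
    (hX : ∃ x ∈ X, x ≠ v) (hY : ∃ y ∈ Y, y ≠ v) :
    ∃ x y S, x ∈ X ∧ y ∈ Y ∧ HP G x y S ∧ v ∉ S ∧ (∀ z ∈ S, z ∈ X → z = x) ∧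
      (∀ z ∈ S, z ∈ Y → z = y) := by
  classical
  have hne : ∃ m, ∃ x y S, x ∈ X ∧ y ∈ Y ∧ HP G x y S ∧ v ∉ S ∧ S.card = m := by
    obtain ⟨x, hx, hxv⟩ := hX
    obtain ⟨y, hy, hyv⟩ := hY
    obtain ⟨S, hS, hv⟩ := hcon x y hxv hyv
    exact ⟨_, x, y, S, hx, hy, hS, hv, rfl⟩
  obtain ⟨x, y, S, hx, hy, hS, hv, hc⟩ := Nat.find_spec hne
  have hmin : ∀ x' y' S', x' ∈ X → y' ∈ Y → HP G x' y' S' → v ∉ S' → S.card ≤ S'.card := by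
    intro x' y' S' a b c' d
    rw [hc]
    exact Nat.find_min' hne ⟨x', y', S', a, b, c', d, rfl⟩
  refine ⟨x, y, S, hx, hy, hS, hv, ?_, ?_⟩
  · intro z hz hzX
    by_contra hne
    obtain ⟨u, S1, S2, h1, h2, h3, h4, h5⟩ := hS.split hz hne
    have := hmin z y S2 hzX hy h3 (by grind)
    have hlt : S2.card < S.card := Finset.card_lt_card
      (Finset.ssubset_iff_subset_ne.2 ⟨by grind, by have := h1.left_mem; grind⟩)
    omega
  · intro z hz hzY
    by_contra hne
    obtain ⟨u, S1, S2, h1, h2, h3, h4, h5⟩ := hS.symm.split hz hne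
    have := hmin x z S2 hx hzY h3.symm (by grind)
    have hlt : S2.card < S.card := Finset.card_lt_card
      (Finset.ssubset_iff_subset_ne.2 ⟨by grind, by have := h1.left_mem; grind⟩)
    omega

/-- Two disjoint paths from `A` to the tail `u r, …, u m`, using `u 0` and `u r`. -/
theorem twoPaths
    (hcon : ∀ v x y, x ≠ v → y ≠ v → ∃ S, HP G x y S ∧ v ∉ S)
    (A : Finset V) (u : ℕ → V) (m : ℕ) (hinj : ∀ i ≤ m, ∀ j ≤ m, u i = u j → i = j)
    (hadj : ∀ i < m, G.Adj (u i) (u (i + 1))) (h0 : u 0 ∈ A)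
    (hA : ∀ i ≤ m, u i ∈ A → i = 0) (hA' : ∃ a ∈ A, a ≠ u 0) (r : ℕ) (hr : r < m) :
    ∃ p q b Q1 Q2, p ∈ A ∧ q ∈ A ∧ (p = u 0 ∨ q = u 0) ∧ r < b ∧ b ≤ m ∧
      HP G p (u r) Q1 ∧ HP G q (u b) Q2 ∧ (∀ z ∈ Q1, z ∉ Q2) ∧
      (∀ z ∈ Q1, z ∈ A → z = p) ∧ (∀ z ∈ Q2, z ∈ A → z = q) ∧
      (∀ i, r ≤ i → i ≤ m → u i ∈ Q1 → i = r) ∧ (∀ i, r ≤ i → i ≤ m → u i ∈ Q2 → i = b) := by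
  induction r with
  | zero =>
    obtain ⟨a, y, S, ha, hy, hS, hv, hX, hY⟩ := firstHit (u 0) (hcon (u 0)) A
      ((Finset.Icc 1 m).image u) hA' ⟨u 1, by simp; exact ⟨1, by omega, rfl⟩, fun e => by
        have := hinj 1 (by omega) 0 (by omega) e
        omega⟩
    obtain ⟨b, hb, rfl⟩ := Finset.mem_image.1 hy
    rw [Finset.mem_Icc] at hb
    refine ⟨u 0, a, b, {u 0}, S, h0, ha, Or.inl rfl, by omega, hb.2, HP.nil _, hS, by grind,
      by grind, hX, ?_, ?_⟩
    · intro i _ hi h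
      exact hinj i hi 0 (by omega) (by simpa using h)
    · intro i _ hi h
      have : i ≠ 0 := by rintro rfl; exact hv h
      exact hinj i hi b hb.2 (hY _ h (Finset.mem_image.2 ⟨i, by simp; omega, rfl⟩))
  | succ r ih =>
    obtain ⟨p, q, b, Q1, Q2, hp, hq, hpq, hb, hbm, h1, h2, hd, hA1, hA2, hU1, hU2⟩ := ih (by omega)
    have hrA : u (r + 1) ∉ A := fun h => by
      have := hA _ (by omega) h
      omega
    have hr1 : u (r + 1) ∉ Q1 := fun h => by
      have := hU1 _ (by omega) (by omega) h
      omega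
    -- extend the first path by one vertex
    have hE : HP G p (u (r + 1)) (Q1 ∪ {u (r + 1)}) :=
      h1.join (hadj r (by omega)) (HP.nil _) (by grind)
    have hEA : ∀ z ∈ Q1 ∪ {u (r + 1)}, z ∈ A → z = p := by grind
    have hEU : ∀ i, r + 1 ≤ i → i ≤ m → u i ∈ Q1 ∪ {u (r + 1)} → i = r + 1 := by
      intro i hi him h
      rw [Finset.mem_union, Finset.mem_singleton] at h
      rcases h with h | h
      · have := hU1 i (by omega) him h
        omega
      · exact hinj i him _ (by omega) h
    by_cases hb1 : b = r + 1
    · subst hb1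
      obtain ⟨d, y, R, hdX, hy, hR, hv, hX, hY⟩ := firstHit (u (r + 1)) (hcon _)
        ((A ∪ Q1 ∪ Q2).erase (u (r + 1))) ((Finset.Icc (r + 2) m).image u)
        ⟨p, by grind, by grind⟩ ⟨u (r + 2), by simp; exact ⟨r + 2, by omega, rfl⟩, fun e => by
          have := hinj (r + 2) (by omega) (r + 1) (by omega) e
          omega⟩
      obtain ⟨b, hb', rfl⟩ := Finset.mem_image.1 hy
      rw [Finset.mem_Icc] at hb'
      have hRU : ∀ i, r + 1 ≤ i → i ≤ m → u i ∈ R → i = b := by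
        intro i hi him h
        have : i ≠ r + 1 := by rintro rfl; exact hv h
        exact hinj i him b hb'.2 (hY _ h (Finset.mem_image.2 ⟨i, by simp; omega, rfl⟩))
      have hRX : ∀ z ∈ R, z ∈ A ∨ z ∈ Q1 ∨ z ∈ Q2 → z = d := by
        intro z hz h
        exact hX z hz (by grind)
      by_cases hd1 : d ∈ Q1
      · obtain ⟨Qa, Qb, g1, g2, g3, g4⟩ := h1.split_at hd1
        refine ⟨q, p, b, Q2, Qa ∪ R, hq, hp, hpq.symm, by omega, hb'.2, h2,
          g1.glue hR (by grind), by grind, by grind, ?_, ?_, ?_⟩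
        · have := g1.right_mem
          grind
        · intro i hi him h
          exact hU2 i (by omega) him h
        · intro i hi him h
          rw [Finset.mem_union] at h
          rcases h with h | h
          · have := hU1 i (by omega) him (by grind)
            omega
          · exact hRU i hi him h
      · by_cases hd2 : d ∈ Q2
        · obtain ⟨Qa, Qb, g1, g2, g3, g4⟩ := h2.split_at hd2
          have hQa : u (r + 1) ∉ Qa := by
            intro h
            have := g3 _ h g2.right_mem
            grind
          refine ⟨p, q, b, Q1 ∪ {u (r + 1)}, Qa ∪ R, hp, hq, hpq, by omega, hb'.2, hE,
            g1.glue hR (by grind), by grind, hEA, ?_, hEU, ?_⟩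
          · have := g1.right_mem
            grind
          · intro i hi him h
            rw [Finset.mem_union] at h
            rcases h with h | h
            · have := hU2 i (by omega) him (by grind)
              subst this
              exact absurd h hQa
            · exact hRU i hi him h
        · have hdA : d ∈ A := by grind
          rcases hpq with rfl | rfl
          · refine ⟨u 0, d, b, Q1 ∪ {u (r + 1)}, R, h0, hdA, Or.inl rfl, by omega, hb'.2, hE, hR,
              by grind, hEA, by grind, hEU, hRU⟩
          · refine ⟨u 0, d, b, Q2, R, h0, hdA, Or.inl rfl, by omega, hb'.2, h2, hR,
              by grind, hA2, by grind, ?_, hRU⟩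
            intro i hi him h
            exact hU2 i (by omega) him h
    · have hr2 : u (r + 1) ∉ Q2 := fun h => by
        have := hU2 _ (by omega) (by omega) h
        omega
      refine ⟨p, q, b, Q1 ∪ {u (r + 1)}, Q2, hp, hq, hpq, by omega, hbm, hE, h2, by grind,
        hEA, hA2, hEU, ?_⟩
      intro i hi him h
      exact hU2 i (by omega) him h

theorem segHP (v : ℕ → V) (l : ℕ) (hinj : ∀ i ≤ l, ∀ j ≤ l, v i = v j → i = j)
    (hadj : ∀ i < l, G.Adj (v i) (v (i + 1))) (i j : ℕ) (hij : i ≤ j) (hj : j ≤ l) :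
    HP G (v i) (v j) ((Finset.Icc i j).image v) := by
  induction j, hij using Nat.le_induction with
  | base => simpa using HP.nil (v i)
  | succ j hij ih =>
    have := (ih (by omega)).join (hadj j (by omega)) (HP.nil _) (by
      intro z hz h
      rw [Finset.mem_singleton] at h
      obtain ⟨a, ha, rfl⟩ := Finset.mem_image.1 hz
      rw [Finset.mem_Icc] at ha
      have := hinj a (by omega) (j + 1) hj h
      omega)
    have e : (Finset.Icc i j).image v ∪ {v (j + 1)} = (Finset.Icc i (j + 1)).image v := by
      rw [← Finset.insert_Icc_right_eq_Icc_add_one (by omega), Finset.image_insert]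
      grind
    rwa [e] at this

theorem HP.toFun {x y : V} {S : Finset V} (h : HP G x y S) : ∃ (v : ℕ → V) (l : ℕ),
    v 0 = x ∧ v l = y ∧ S = (Finset.Icc 0 l).image v ∧ (∀ i ≤ l, ∀ j ≤ l, v i = v j → i = j) ∧
    (∀ i < l, G.Adj (v i) (v (i + 1))) := by
  obtain ⟨p, hp, e⟩ := h.toWalk
  refine ⟨p.getVert, p.length, by simp, by simp, ?_, ?_, ?_⟩
  · rw [← e]
    ext z
    simp [SimpleGraph.Walk.mem_support_iff_exists_getVert, and_comm]
  · intro i hi j hj h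
    exact hp.getVert_injOn hi hj h
  · intro i hi
    exact p.adj_getVert_succ hi

end

section
variable {V : Type*} [DecidableEq V] {G : SimpleGraph V}

theorem endPath (v : ℕ → V) (l : ℕ) (hinj : ∀ i ≤ l, ∀ j ≤ l, v i = v j → i = j)
    (hadj : ∀ i < l, G.Adj (v i) (v (i + 1))) (s a : ℕ) (hs : s ≤ l) (ha : a < s)
    (hvs : G.Adj (v 0) (v s)) :
    ∃ T, HP G (v a) (v s) T ∧ T ⊆ (Finset.Icc 0 s).image v ∧ v 0 ∈ T ∧
      ∀ i ≤ s, G.Adj (v 0) (v i) → v i ∈ T := by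
  classical
  have hex : ∃ j, a < j ∧ G.Adj (v 0) (v j) := ⟨s, ha, hvs⟩
  obtain ⟨h1, h2⟩ := Nat.find_spec hex
  have h3 : Nat.find hex ≤ s := Nat.find_min' hex ⟨ha, hvs⟩
  have h4 : ∀ i, a < i → G.Adj (v 0) (v i) → Nat.find hex ≤ i :=
    fun i h h' => Nat.find_min' hex ⟨h, h'⟩
  generalize Nat.find hex = j at *
  refine ⟨(Finset.Icc 0 a).image v ∪ (Finset.Icc j s).image v,
    (segHP v l hinj hadj 0 a (by omega) (by omega)).symm.join h2
      (segHP v l hinj hadj j s h3 hs) ?_, ?_, ?_, ?_⟩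
  · intro z hz hz'
    obtain ⟨i, hi, rfl⟩ := Finset.mem_image.1 hz
    obtain ⟨i', hi', e⟩ := Finset.mem_image.1 hz'
    rw [Finset.mem_Icc] at hi hi'
    have := hinj i' (by omega) i (by omega) e
    omega
  · rw [← Finset.image_union]
    apply Finset.image_subset_image
    intro i
    simp only [Finset.mem_union, Finset.mem_Icc]
    omega
  · exact Finset.mem_union_left _ (Finset.mem_image_of_mem _ (by simp))
  · intro i hi hA
    by_cases hia : i ≤ a
    · exact Finset.mem_union_left _ (Finset.mem_image_of_mem _ (by simp; omega))
    · have := h4 i (by omega) hA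
      exact Finset.mem_union_right _ (Finset.mem_image_of_mem _ (by simp; omega))

theorem noCross [Fintype V] [DecidableRel G.Adj] (k c : ℕ) (hk : 2 ≤ k)
    (hcon : ∀ v x y, x ≠ v → y ≠ v → ∃ S, HP G x y S ∧ v ∉ S)
    (hmin : ∀ v : V, k ≤ G.degree v)
    (hmax : ∀ (v : V) (w : G.Walk v v), w.IsCycle → w.length ≤ c)
    (v : ℕ → V) (l : ℕ) (hinj : ∀ i ≤ l, ∀ j ≤ l, v i = v j → i = j)
    (hadj : ∀ i < l, G.Adj (v i) (v (i + 1)))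
    (hN0 : ∀ z, G.Adj (v 0) z → ∃ i ≤ l, z = v i)
    (hNl : ∀ z, G.Adj (v l) z → ∃ i ≤ l, z = v i)
    (s t : ℕ) (hst : s ≤ t) (hs : 2 ≤ s) (ht : t + 2 ≤ l)
    (hvs : G.Adj (v 0) (v s)) (hvt : G.Adj (v l) (v t))
    (hsmax : ∀ i ≤ l, G.Adj (v 0) (v i) → i ≤ s) (htmin : ∀ i ≤ l, G.Adj (v l) (v i) → t ≤ i) :
    2 * k ≤ c := by
  obtain ⟨p, q, b, Q1, Q2, hp, hq, hpq, hb, hbm, h1, h2, hd, hA1, hA2, hU1, hU2⟩ :=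
    twoPaths (G := G) hcon ((Finset.Icc 0 s).image v) (fun i => v (s + i)) (l - s)
      (by intro i hi j hj h
          have := hinj _ (by omega) _ (by omega) h
          omega)
      (by intro i hi
          exact hadj (s + i) (by omega))
      (Finset.mem_image_of_mem _ (by simp))
      (by intro i hi h
          obtain ⟨j, hj, e⟩ := Finset.mem_image.1 h
          rw [Finset.mem_Icc] at hj
          have := hinj _ (by omega) _ (by omega) e
          omega)
      ⟨v 0, Finset.mem_image_of_mem _ (by simp), fun e => by
        have := hinj _ (by omega) _ (by omega) e
        omega⟩ (t - s) (by omega)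
  simp only [add_zero] at hpq
  rw [show s + (t - s) = t by omega] at h1
  -- convert to indices of `v`
  obtain ⟨b', rfl⟩ : ∃ b', b' = s + b := ⟨_, rfl⟩
  set B := s + b with hB
  have hV1 : ∀ i, t ≤ i → i ≤ l → v i ∈ Q1 → i = t := by
    intro i hi hil h
    have := hU1 (i - s) (by omega) (by omega) (by rwa [show s + (i - s) = i by omega])
    omega
  have hV2 : ∀ i, t ≤ i → i ≤ l → v i ∈ Q2 → i = B := by
    intro i hi hil h
    have := hU2 (i - s) (by omega) (by omega) (by rwa [show s + (i - s) = i by omega])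
    omega
  have hne : p ≠ q := by
    rintro rfl
    exact hd p h1.left_mem h2.left_mem
  -- path on the left
  have hL : ∃ T, HP G p q T ∧ T ⊆ (Finset.Icc 0 s).image v ∧ v 0 ∈ T ∧
      ∀ i ≤ s, G.Adj (v 0) (v i) → v i ∈ T := by
    obtain ⟨i, hi, rfl⟩ := Finset.mem_image.1 hp
    obtain ⟨j, hj, rfl⟩ := Finset.mem_image.1 hq
    rw [Finset.mem_Icc] at hi hj
    rcases hpq with e | e
    · have := hinj _ (by omega) _ (by omega) e
      subst this
      have : j ≠ i := by rintro rfl; exact hne rfl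
      obtain ⟨T, hT, hT'⟩ := endPath v l hinj hadj i j (by omega) (by omega) hvs
      exact ⟨T, hT.symm, hT'⟩
    · have := hinj _ (by omega) _ (by omega) e
      subst this
      have : i ≠ j := by rintro rfl; exact hne rfl
      exact endPath v l hinj hadj j i (by omega) (by omega) hvs
  obtain ⟨T, hT, hTs, hT0, hTN⟩ := hL
  obtain ⟨T', hT', hTs', hT0', hTN'⟩ := endPath (G := G) (fun i => v (l - i)) l
    (by intro i hi j hj h
        have := hinj _ (by omega) _ (by omega) h
        omega)
    (by intro i hi
        have := hadj (l - (i + 1)) (by omega)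
        rw [show l - (i + 1) + 1 = l - i by omega] at this
        exact this.symm) (l - t) (l - B) (by omega) (by omega)
    (by simpa [show l - (l - t) = t by omega] using hvt)
  simp only [Nat.sub_zero] at hT0' hTN'
  rw [show l - (l - t) = t by omega, show l - (l - B) = B by omega] at hT'
  have hTm : ∀ z ∈ T, ∃ i ≤ s, z = v i := by
    intro z hz
    obtain ⟨i, hi, rfl⟩ := Finset.mem_image.1 (hTs hz)
    exact ⟨i, by simpa using hi, rfl⟩
  have hTm' : ∀ z ∈ T', ∃ i, t ≤ i ∧ i ≤ l ∧ z = v i := by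
    intro z hz
    obtain ⟨i, hi, rfl⟩ := Finset.mem_image.1 (hTs' hz)
    rw [Finset.mem_Icc] at hi
    exact ⟨l - i, by omega, by omega, rfl⟩
  have hTT : ∀ z ∈ T, z ∈ T' → z = v s ∧ z = v t := by
    intro z hz hz'
    obtain ⟨i, hi, rfl⟩ := hTm z hz
    obtain ⟨j, hj, hjl, e⟩ := hTm' _ hz'
    have := hinj _ (by omega) _ (by omega) e
    have e1 : i = s := by omega
    have e2 : i = t := by omega
    exact ⟨by rw [e1], by rw [← e2]⟩
  have hW := (h1.symm.glue hT (fun z hz hz' => hA1 z hz (hTs hz'))).glue h2 (by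
    intro z hz hz'
    rcases Finset.mem_union.1 hz with h | h
    · exact absurd hz' (hd z h)
    · exact hA2 z hz' (hTs h))
  have hmemT' : ∀ z, G.Adj (v l) z → z ∈ T' := by
    intro z hz
    obtain ⟨i, hi, rfl⟩ := hNl z hz
    have := htmin i hi hz
    have := hTN' (l - i) (by omega) (by rwa [show l - (l - i) = i by omega])
    rwa [show l - (l - i) = i by omega] at this
  have hmemT : ∀ z, G.Adj (v 0) z → z ∈ T := by
    intro z hz
    obtain ⟨i, hi, rfl⟩ := hN0 z hz
    exact hTN i (hsmax i hi hz) hz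
  have hcT : k + 1 ≤ T.card := by
    have h : insert (v 0) (G.neighborFinset (v 0)) ⊆ T := by
      intro z hz
      rw [Finset.mem_insert, SimpleGraph.mem_neighborFinset] at hz
      rcases hz with rfl | hz
      · exact hT0
      · exact hmemT z hz
    have := Finset.card_le_card h
    rw [Finset.card_insert_of_notMem (by simp), SimpleGraph.card_neighborFinset_eq_degree] at this
    have := hmin (v 0)
    omega
  have hcT' : k + 1 ≤ T'.card := by
    have h : insert (v l) (G.neighborFinset (v l)) ⊆ T' := by
      intro z hz
      rw [Finset.mem_insert, SimpleGraph.mem_neighborFinset] at hz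
      rcases hz with rfl | hz
      · exact hT0'
      · exact hmemT' z hz
    have := Finset.card_le_card h
    rw [Finset.card_insert_of_notMem (by simp), SimpleGraph.card_neighborFinset_eq_degree] at this
    have := hmin (v l)
    omega
  have hcyc := hW.cycle2 hT'.symm (by
      intro z hz hz'
      rcases Finset.mem_union.1 hz with h | h
      · rcases Finset.mem_union.1 h with h | h
        · obtain ⟨i, hi, hil, rfl⟩ := hTm' z hz'
          exact Or.inl (by rw [hV1 i hi hil h])
        · exact Or.inl (hTT z h hz').2
      · obtain ⟨i, hi, hil, rfl⟩ := hTm' z hz'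
        exact Or.inr (by rw [hV2 i hi hil h]))
    (by intro e
        have := hinj _ (by omega) _ (by omega) e
        omega)
    (by
      by_contra hcon'
      push Not at hcon'
      have : T' ⊆ {v t, v B} := by
        intro z hz
        have := hcon' z hz
        grind
      have := Finset.card_le_card this
      have := Finset.card_le_two (a := v t) (b := v B)
      omega) hmax
  have hsub : T ∪ T' ⊆ Q1 ∪ T ∪ Q2 ∪ T' := by grind
  have h5 := Finset.card_le_card hsub
  have h6 := Finset.card_union_add_card_inter T T'
  have h7 : (T ∩ T').card ≤ 1 := by
    refine (Finset.card_le_card (t := {v s}) ?_).trans (by simp)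
    intro z hz
    rw [Finset.mem_inter] at hz
    simpa using (hTT z hz.1 hz.2).1
  omega

theorem crossing [Fintype V] [DecidableRel G.Adj] (k c : ℕ) (hk : 2 ≤ k)
    (hmin : ∀ v : V, k ≤ G.degree v)
    (hmax : ∀ (v : V) (w : G.Walk v v), w.IsCycle → w.length ≤ c)
    (v : ℕ → V) (l : ℕ) (hinj : ∀ i ≤ l, ∀ j ≤ l, v i = v j → i = j)
    (hadj : ∀ i < l, G.Adj (v i) (v (i + 1)))
    (hN0 : ∀ z, G.Adj (v 0) z → ∃ i ≤ l, z = v i)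
    (hNl : ∀ z, G.Adj (v l) z → ∃ i ≤ l, z = v i)
    (hnoc : ∀ i < l, G.Adj (v 0) (v (i + 1)) → ¬ G.Adj (v l) (v i))
    (hcr : ∃ d i, i + d ≤ l ∧ 0 < d ∧ G.Adj (v 0) (v (i + d)) ∧ G.Adj (v l) (v i)) :
    2 * k ≤ c := by
  classical
  obtain ⟨i, hil, hd, h0, hl⟩ := Nat.find_spec hcr
  have hmind : ∀ d i, i + d ≤ l → 0 < d → G.Adj (v 0) (v (i + d)) → G.Adj (v l) (v i) →
      Nat.find hcr ≤ d := fun d i h1 h2 h3 h4 => Nat.find_min' hcr ⟨i, h1, h2, h3, h4⟩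
  generalize Nat.find hcr = d at *
  have hd1 : d ≠ 1 := by
    rintro rfl
    exact hnoc i (by omega) h0 hl
  -- the index sets
  let S := (Finset.range l).filter (fun t => G.Adj (v 0) (v (t + 1)))
  let T := (Finset.range l).filter (fun t => G.Adj (v l) (v t))
  have hS : k ≤ S.card := by
    refine (hmin (v 0)).trans ?_
    rw [← SimpleGraph.card_neighborFinset_eq_degree]
    have : G.neighborFinset (v 0) ⊆ S.image (fun t => v (t + 1)) := by
      intro z hz
      rw [SimpleGraph.mem_neighborFinset] at hz
      obtain ⟨j, hj, rfl⟩ := hN0 z hz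
      have : j ≠ 0 := by rintro rfl; exact G.irrefl hz
      refine Finset.mem_image.2 ⟨j - 1, ?_, by rw [show j - 1 + 1 = j by omega]⟩
      simp only [S, Finset.mem_filter, Finset.mem_range]
      rw [show j - 1 + 1 = j by omega]
      exact ⟨by omega, hz⟩
    exact (Finset.card_le_card this).trans Finset.card_image_le
  have hT : k ≤ T.card := by
    refine (hmin (v l)).trans ?_
    rw [← SimpleGraph.card_neighborFinset_eq_degree]
    have : G.neighborFinset (v l) ⊆ T.image v := by
      intro z hz
      rw [SimpleGraph.mem_neighborFinset] at hz
      obtain ⟨j, hj, rfl⟩ := hNl z hz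
      have : j ≠ l := by rintro rfl; exact G.irrefl hz
      refine Finset.mem_image.2 ⟨j, ?_, rfl⟩
      simp only [T, Finset.mem_filter, Finset.mem_range]
      exact ⟨by omega, hz⟩
    exact (Finset.card_le_card this).trans Finset.card_image_le
  have hdis : Disjoint S T := by
    rw [Finset.disjoint_left]
    intro t h1 h2
    simp only [S, T, Finset.mem_filter, Finset.mem_range] at h1 h2
    exact hnoc t h1.1 h1.2 h2.2
  have hsub : S ∪ T ⊆ Finset.range (i + 1) ∪ Finset.Ico (i + d - 1) l := by
    intro t ht
    simp only [S, T, Finset.mem_union, Finset.mem_filter, Finset.mem_range, Finset.mem_Ico] at ht ⊢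
    by_contra hcon
    rcases ht with ht | ht
    · have := hmind (t + 1 - i) i (by omega) (by omega)
        (by rw [show i + (t + 1 - i) = t + 1 by omega]; exact ht.2) hl
      omega
    · have := hmind (i + d - t) t (by omega) (by omega)
        (by rw [show t + (i + d - t) = i + d by omega]; exact h0) ht.2
      omega
  have h1 := Finset.card_le_card hsub
  rw [Finset.card_union_of_disjoint hdis] at h1
  have h2 := h1.trans (Finset.card_union_le _ _)
  rw [Finset.card_range, Nat.card_Ico] at h2
  have hP := (segHP v l hinj hadj 0 i (by omega) (by omega)).join hl.symm
    (segHP v l hinj hadj (i + d) l hil le_rfl).symm (by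
      intro z hz hz'
      obtain ⟨a, ha, rfl⟩ := Finset.mem_image.1 hz
      obtain ⟨a', ha', e⟩ := Finset.mem_image.1 hz'
      rw [Finset.mem_Icc] at ha ha'
      have := hinj a' (by omega) a (by omega) e
      omega)
  have hcard : ((Finset.Icc 0 i).image v ∪ (Finset.Icc (i + d) l).image v).card
      = (i + 1) + (l + 1 - (i + d)) := by
    rw [← Finset.image_union, Finset.card_image_of_injOn, Finset.card_union_of_disjoint]
    · simp
    · rw [Finset.disjoint_left]
      intro a
      simp only [Finset.mem_Icc]
      omega
    · intro a ha a' ha' e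
      simp only [Finset.coe_union, Finset.coe_Icc, Set.mem_union, Set.mem_Icc] at ha ha'
      exact hinj a (by omega) a' (by omega) e
  have := hP.cycle h0 (by omega) hmax
  omega

end

/-- If `G` is a 2-connected `n`-vertex graph with minimum degree exactly `k ≥ 2` and
circumference `c` satisfying `n ≥ c + 1`, then `c ≥ 2k`. -/
theorem circumference_ge_two_min_degree {V : Type*} [Fintype V] [DecidableEq V]
    (G : SimpleGraph V) [DecidableRel G.Adj] (n k c : ℕ)
    (hn : Fintype.card V = n) (hk : 2 ≤ k)
    (h2 : TwoConnected G)
    (hmin : ∀ v : V, k ≤ G.degree v) (hex : ∃ v : V, G.degree v = k)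
    (hcyc : ∃ (v : V) (w : G.Walk v v), w.IsCycle ∧ w.length = c)
    (hmax : ∀ (v : V) (w : G.Walk v v), w.IsCycle → w.length ≤ c)
    (hnc : c + 1 ≤ n) :
    2 * k ≤ c := by
  obtain ⟨-, hconn, hdel⟩ := h2
  have hcon : ∀ v x y, x ≠ v → y ≠ v → ∃ S, HP G x y S ∧ v ∉ S := by
    intro v x y hx hy
    let H := (⊤ : G.Subgraph).deleteVerts {v}
    have hx' : x ∈ H.verts := by simp [H, hx]
    have hy' : y ∈ H.verts := by simp [H, hy]
    obtain ⟨p⟩ := (hdel v).preconnected ⟨x, hx'⟩ ⟨y, hy'⟩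
    let p' : G.Walk x y := p.map H.hom
    have hv : v ∉ p'.support := by
      intro h
      have h := (SimpleGraph.Walk.support_map H.hom p) ▸ (show v ∈ (p.map H.hom).support from h)
      rw [List.mem_map] at h
      obtain ⟨⟨z, hz⟩, _, e⟩ := h
      change z = v at e
      simp [H, e] at hz
    refine ⟨p'.bypass.support.toFinset, HP.ofWalk _ p'.bypass_isPath, fun h => hv ?_⟩
    exact p'.support_bypass_subset_support (by simpa using h)
  -- a longest path
  obtain ⟨P, hP, hPmax⟩ : ∃ P : Finset V, (∃ x y, HP G x y P) ∧
      ∀ S : Finset V, (∃ x y, HP G x y S) → S.card ≤ P.card := by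
    obtain ⟨v0, -⟩ := hex
    obtain ⟨P, hP, h⟩ := Set.exists_max_image {S : Finset V | ∃ x y, HP G x y S} Finset.card
      (Set.toFinite _) ⟨{v0}, v0, v0, HP.nil v0⟩
    exact ⟨P, hP, h⟩
  obtain ⟨x, y, hxy⟩ := hP
  have hends : ∀ x y, HP G x y P → ∀ z, G.Adj x z → z ∈ P := by
    intro x y h z hz
    by_contra hzP
    have := hPmax _ ⟨z, y, HP.cons hz.symm h hzP⟩
    rw [Finset.card_insert_of_notMem hzP] at this
    omega
  have hP3 : 3 ≤ P.card := by
    have h : insert x (G.neighborFinset x) ⊆ P := by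
      intro z hz
      rw [Finset.mem_insert, SimpleGraph.mem_neighborFinset] at hz
      rcases hz with rfl | hz
      · exact hxy.left_mem
      · exact hends _ _ hxy z hz
    have := Finset.card_le_card h
    rw [Finset.card_insert_of_notMem (by simp), SimpleGraph.card_neighborFinset_eq_degree] at this
    have := hmin x
    omega
  have hnocyc : ∀ x y, HP G x y P → ¬ G.Adj x y := by
    intro x y h ha
    have hlt := h.cycle ha hP3 hmax
    obtain ⟨z, hz⟩ : ∃ z, z ∉ P := by
      by_contra hcon'
      push Not at hcon'
      have : P = Finset.univ := by ext; simp [hcon']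
      rw [this, Finset.card_univ] at hlt
      omega
    obtain ⟨p⟩ := hconn.preconnected x z
    obtain ⟨d, _, hd1, hd2⟩ := p.exists_boundary_dart (↑P : Set V) (by simpa using h.left_mem)
      (by simpa using hz)
    have hd1 : d.fst ∈ P := by simpa using hd1
    have hd2 : d.snd ∉ P := by simpa using hd2
    by_cases e : d.fst = x
    · exact hd2 (hends x y h _ (e ▸ d.adj))
    · obtain ⟨u, S1, S2, g1, g2, g3, g4, g5⟩ := h.split hd1 e
      have := g3.join ha.symm g1 (by grind)
      rw [show S2 ∪ S1 = P by grind] at this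
      exact hd2 (hends _ _ this _ d.adj)
  obtain ⟨v, l, rfl, rfl, hPv, hinj, hadj⟩ := hxy.toFun
  have hN0 : ∀ z, G.Adj (v 0) z → ∃ i ≤ l, z = v i := by
    intro z hz
    have := hends _ _ hxy z hz
    rw [hPv] at this
    obtain ⟨i, hi, rfl⟩ := Finset.mem_image.1 this
    exact ⟨i, by simpa using hi, rfl⟩
  have hNl : ∀ z, G.Adj (v l) z → ∃ i ≤ l, z = v i := by
    intro z hz
    have := hends _ _ hxy.symm z hz
    rw [hPv] at this
    obtain ⟨i, hi, rfl⟩ := Finset.mem_image.1 this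
    exact ⟨i, by simpa using hi, rfl⟩
  have hnoc : ∀ i < l, G.Adj (v 0) (v (i + 1)) → ¬ G.Adj (v l) (v i) := by
    intro i hi h0 hl
    have := (segHP v l hinj hadj 0 i (by omega) (by omega)).join hl.symm
      (segHP v l hinj hadj (i + 1) l (by omega) le_rfl).symm (by
        intro z hz hz'
        obtain ⟨a, ha, rfl⟩ := Finset.mem_image.1 hz
        obtain ⟨a', ha', e⟩ := Finset.mem_image.1 hz'
        rw [Finset.mem_Icc] at ha ha'
        have := hinj a' (by omega) a (by omega) e
        omega)
    rw [← Finset.image_union, show Finset.Icc 0 i ∪ Finset.Icc (i + 1) l = Finset.Icc 0 l by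
      ext a
      simp only [Finset.mem_union, Finset.mem_Icc]
      omega, ← hPv] at this
    exact hnocyc _ _ this h0
  by_cases hcr : ∃ d i, i + d ≤ l ∧ 0 < d ∧ G.Adj (v 0) (v (i + d)) ∧ G.Adj (v l) (v i)
  · exact crossing k c hk hmin hmax v l hinj hadj hN0 hNl hnoc hcr
  push Not at hcr
  -- each end vertex has a neighbour other than its path neighbour
  have hs0 : ∃ i, 2 ≤ i ∧ i ≤ l ∧ G.Adj (v 0) (v i) := by
    by_contra hcon'
    push Not at hcon'
    have : G.neighborFinset (v 0) ⊆ {v 1} := by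
      intro z hz
      rw [SimpleGraph.mem_neighborFinset] at hz
      obtain ⟨i, hi, rfl⟩ := hN0 z hz
      have h0 : i ≠ 0 := by rintro rfl; exact G.irrefl hz
      have : ¬ 2 ≤ i := fun h => hcon' i h hi hz
      have : i = 1 := by omega
      simp [this]
    have := Finset.card_le_card this
    rw [SimpleGraph.card_neighborFinset_eq_degree, Finset.card_singleton] at this
    have := hmin (v 0)
    omega
  have ht0 : ∃ i, i + 2 ≤ l ∧ G.Adj (v l) (v i) := by
    by_contra hcon'
    push Not at hcon'
    have : G.neighborFinset (v l) ⊆ {v (l - 1)} := by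
      intro z hz
      rw [SimpleGraph.mem_neighborFinset] at hz
      obtain ⟨i, hi, rfl⟩ := hNl z hz
      have h0 : i ≠ l := by rintro rfl; exact G.irrefl hz
      have : ¬ i + 2 ≤ l := fun h => hcon' i h hz
      have : i = l - 1 := by omega
      simp [this]
    have := Finset.card_le_card this
    rw [SimpleGraph.card_neighborFinset_eq_degree, Finset.card_singleton] at this
    have := hmin (v l)
    omega
  obtain ⟨s0, hs2, hsl, hsa⟩ := hs0
  obtain ⟨s, ⟨hs1, hvs⟩, hsmax⟩ : ∃ s, (s ≤ l ∧ G.Adj (v 0) (v s)) ∧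
      ∀ i ≤ l, G.Adj (v 0) (v i) → i ≤ s := by
    obtain ⟨s, hs, h⟩ := Set.exists_max_image {i | i ≤ l ∧ G.Adj (v 0) (v i)} id
      ((Set.finite_Iic l).subset fun i hi => hi.1) ⟨s0, hsl, hsa⟩
    exact ⟨s, hs, fun i h1 h2 => h i ⟨h1, h2⟩⟩
  obtain ⟨t0, ht2, hta⟩ := ht0
  obtain ⟨t, ⟨ht1, hvt⟩, htmin⟩ : ∃ t, (t ≤ l ∧ G.Adj (v l) (v t)) ∧
      ∀ i ≤ l, G.Adj (v l) (v i) → t ≤ i := by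
    obtain ⟨s, hs, h⟩ := Set.exists_min_image {i | i ≤ l ∧ G.Adj (v l) (v i)} id
      ((Set.finite_Iic l).subset fun i hi => hi.1) ⟨t0, by omega, hta⟩
    exact ⟨s, hs, fun i h1 h2 => h i ⟨h1, h2⟩⟩
  have a1 := hsmax s0 hsl hsa
  have a2 := htmin t0 (by omega) hta
  have hst : s ≤ t := by
    by_contra h
    exact hcr (s - t) t (by omega) (by omega)
      (by rwa [show t + (s - t) = s by omega]) hvt
  exact noCross k c hk hcon hmin hmax v l hinj hadj hN0 hNl s t hst (by omega) (by omega)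
    hvs hvt hsmax htmin
end

section
/- Let G be a 2-connected graph, C a cycle of G, and H a connected component of G − V(C). If every vertex v of H has degree at least k in G, then G contains a subgraph consisting of t ≥ 2 paths P₁, …, P_t sharing one common endpoint in H and ending at t distinct vertices of C, where all internal vertices of P₁ lie in H, P₂, …, P_t are single edges, and the total number of edges is at least k. -/
open SimpleGraph in
/-- cut form of connectedness -/
lemma cut_of_connected {W : Type*} {G : SimpleGraph W} (h : G.Connected) (S : Set W)
    (a b : W) (ha : a ∈ S) (hb : b ∉ S) : ∃ s ∈ S, ∃ y, y ∉ S ∧ G.Adj s y := by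
  obtain ⟨p⟩ := h.preconnected a b
  obtain ⟨d, _, h1, h2⟩ := p.exists_boundary_dart S ha hb
  exact ⟨d.fst, h1, d.snd, h2, d.adj⟩

lemma exists_min_finset {V : Type*} (P : Finset V → Prop) (h : ∃ S, P S) :
    ∃ S, P S ∧ ∀ T, T ⊆ S → T ≠ S → ¬ P T := by
  classical
  obtain ⟨S, hS⟩ := h
  obtain ⟨m, -, hm⟩ := exists_minimal_le_of_wellFoundedLT P S hS
  refine ⟨m, hm.prop, fun T hT hne hP => hne ?_⟩
  exact Finset.Subset.antisymm hT (hm.le_of_le hP hT)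

lemma broom_key {V : Type*} [Fintype V] [DecidableEq V]
    (G : SimpleGraph V) [DecidableRel G.Adj] (n : ℕ) :
    ∀ (H D : Finset V) (c : V) (k : ℕ), H.card ≤ n →
      c ∉ H → c ∉ D → Disjoint H D →
      (∀ S ⊆ H, S.Nonempty → S ≠ H → ∃ s ∈ S, ∃ y ∈ H, y ∉ S ∧ G.Adj s y) →
      (∀ S ⊆ H, S.Nonempty → ∀ x, ∃ s ∈ S, ∃ y, y ∉ S ∧ y ∉ D ∧ y ≠ x ∧ G.Adj s y) →
      (∃ u ∈ H, G.Adj u c) →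
      (∀ v ∈ H, k ≤ (G.neighborFinset v \ D).card) →
      ∃ v ∈ H, ∃ p : G.Walk v c, p.IsPath ∧ (∀ z ∈ p.support, z ≠ c → z ∈ H) ∧
        ∃ E : Finset V, E.Nonempty ∧ (∀ e ∈ E, G.Adj v e ∧ e ∉ H ∧ e ∉ D ∧ e ≠ c) ∧
          k ≤ p.length + E.card := by
  induction n with
  | zero =>
    intro H D c k hn _ _ _ _ _ ⟨u, hu, _⟩ _
    have : H = ∅ := by simpa using hn
    simp [this] at hu
  | succ n ih =>
    intro H D c k hn hcH hcD hHD hconn h2 ⟨u, hu, huc⟩ hdeg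
    by_cases hsing : H = {u}
    · subst hsing
      refine ⟨u, by simp, huc.toWalk, ?_, ?_, (G.neighborFinset u \ D).erase c, ?_, ?_, ?_⟩
      · have := huc.ne
        simp [SimpleGraph.Adj.toWalk, this]
      · intro z hz hzc
        simp [SimpleGraph.Adj.toWalk] at hz
        rcases hz with rfl | rfl
        · simp
        · exact absurd rfl hzc
      · obtain ⟨s, hs, y, hy, hyD, hyc, hsy⟩ := h2 {u} (by simp) (by simp) c
        have : s = u := by simpa using hs
        subst this
        exact ⟨y, by simp [hyc, hyD, hsy]⟩
      · intro e he
        simp only [Finset.mem_erase, Finset.mem_sdiff, SimpleGraph.mem_neighborFinset] at he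
        refine ⟨he.2.1, ?_, he.2.2, he.1⟩
        have := he.2.1.ne'
        simpa using this
      · have h1 := hdeg u (by simp)
        have h3 : c ∈ G.neighborFinset u \ D := by simp [huc, hcD]
        have h4 := Finset.card_erase_add_one h3
        simp only [SimpleGraph.Adj.toWalk, SimpleGraph.Walk.length_cons,
          SimpleGraph.Walk.length_nil]
        omega
    by_cases hA : ∃ S : Finset V, S ⊆ H ∧ S.Nonempty ∧ S ≠ H ∧ ∃ x, ∀ s ∈ S, ∀ y, y ∉ S → y ∉ D →
        y ≠ c → G.Adj s y → y = x
    · obtain ⟨S, ⟨hSH, hSne, hSprop, x, hx⟩, hmin⟩ := exists_min_finset _ hA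
      have hxS : x ∈ H ∧ x ∉ S := by
        obtain ⟨s, hs, y, hy, hyS, hsy⟩ := hconn S hSH hSne hSprop
        have : y = x := hx s hs y hyS (Finset.disjoint_left.1 hHD hy)
          (fun h => hcH (h ▸ hy)) hsy
        exact this ▸ ⟨hy, hyS⟩
      have hcard : S.card < H.card := Finset.card_lt_card (hSH.ssubset_of_ne hSprop)
      obtain ⟨v, hv, p, hp, hpS, E, hEne, hE, hk⟩ := ih S D c k (by omega)
        (fun h => hcH (hSH h)) hcD (Finset.disjoint_of_subset_left hSH hHD)
        (by
          intro T hT hTne hTS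
          by_contra hcon
          push Not at hcon
          refine hmin T hT hTS ⟨hT.trans hSH, hTne, fun h => ?_, x, ?_⟩
          · exact hTS (Finset.Subset.antisymm hT (h ▸ hSH))
          · intro s hs y hyT hyD hyc hsy
            refine hx s (hT hs) y (fun hyS => ?_) hyD hyc hsy
            exact hcon s hs y hyS hyT hsy)
        (fun T hT => h2 T (hT.trans hSH))
        (by
          obtain ⟨s, hs, y, hyS, hyD, hyx, hsy⟩ := h2 S hSH hSne x
          by_cases hyc : y = c
          · exact ⟨s, hs, hyc ▸ hsy⟩
          · exact absurd (hx s hs y hyS hyD hyc hsy) hyx)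
        (fun v hv => hdeg v (hSH hv))
      have hEx : ∀ e ∈ E, e = x := fun e he => by
        obtain ⟨h1, h2, h3, h4⟩ := hE e he
        exact hx v hv e h2 h3 h4 h1
      have hEcard : E.card ≤ 1 := Finset.card_le_one.2 fun a ha b hb => by
        rw [hEx a ha, hEx b hb]
      have hvx : G.Adj v x := by
        obtain ⟨e, he⟩ := hEne
        exact hEx e he ▸ (hE e he).1
      classical
      let R : Finset V := Finset.univ.filter fun r =>
        ∃ q : G.Walk r x, ∀ z ∈ q.support, z ∈ H ∧ z ∉ S
      have hRmem : ∀ r, r ∈ R ↔ ∃ q : G.Walk r x, ∀ z ∈ q.support, z ∈ H ∧ z ∉ S := by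
        intro r; simp [R]
      have hRH : R ⊆ H := by
        intro r hr
        obtain ⟨q, hq⟩ := (hRmem r).1 hr
        exact (hq r q.start_mem_support).1
      have hxR : x ∈ R := (hRmem x).2 ⟨SimpleGraph.Walk.nil, by simpa using hxS⟩
      obtain ⟨r, hr, d, hdSR, hdD, hdc, hrd⟩ := h2 (S ∪ R) (Finset.union_subset hSH hRH)
        ⟨x, Finset.mem_union_right _ hxR⟩ c
      rw [Finset.mem_union, not_or] at hdSR
      have hrR : r ∈ R := by
        rcases Finset.mem_union.1 hr with h | h
        · exact absurd (hx r h d hdSR.1 hdD hdc hrd ▸ hxR) hdSR.2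
        · exact h
      obtain ⟨q, hq⟩ := (hRmem r).1 hrR
      have hdH : d ∉ H := fun hdH => hdSR.2 <| (hRmem d).2
        ⟨SimpleGraph.Walk.cons hrd.symm q, by
          intro z hz
          rw [SimpleGraph.Walk.support_cons, List.mem_cons] at hz
          rcases hz with rfl | hz
          · exact ⟨hdH, hdSR.1⟩
          · exact hq z hz⟩
      have hq' : ∀ z ∈ q.bypass.support, z ∈ H ∧ z ∉ S := fun z hz =>
        hq z (SimpleGraph.Walk.support_bypass_subset_support q hz)
      refine ⟨r, hRH hrR, q.bypass.append (SimpleGraph.Walk.cons hvx.symm p), ?_, ?_, {d},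
        by simp, ?_, ?_⟩
      · rw [SimpleGraph.Walk.isPath_def, SimpleGraph.Walk.support_append,
          SimpleGraph.Walk.support_cons, List.tail_cons]
        refine List.Nodup.append q.bypass_isPath.support_nodup hp.support_nodup ?_
        intro z hz1 hz2
        have h1 := hq' z hz1
        by_cases hzc : z = c
        · exact hcH (hzc ▸ h1.1)
        · exact h1.2 (hpS z hz2 hzc)
      · intro z hz hzc
        rw [SimpleGraph.Walk.support_append,
          SimpleGraph.Walk.support_cons, List.tail_cons, List.mem_append] at hz
        rcases hz with hz | hz
        · exact (hq' z hz).1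
        · exact hSH (hpS z hz hzc)
      · intro e he
        rw [Finset.mem_singleton] at he
        subst he
        exact ⟨hrd, hdH, hdD, hdc⟩
      · simp only [SimpleGraph.Walk.length_append, SimpleGraph.Walk.length_cons,
          Finset.card_singleton]
        omega
    · push Not at hA
      have hex : ∃ T : Finset V, T ⊆ H.erase u ∧ T.Nonempty ∧
          ∀ s ∈ T, ∀ y ∈ H, y ∉ T → G.Adj s y → y = u := by
        refine ⟨H.erase u, subset_rfl, ?_, ?_⟩
        · rw [Finset.nonempty_iff_ne_empty]
          intro h
          rcases (Finset.erase_eq_empty_iff H u).1 h with h | h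
          · simp [h] at hu
          · exact hsing h
        · intro s _ y hy hyn _
          by_contra hne
          exact hyn (Finset.mem_erase.2 ⟨hne, hy⟩)
      obtain ⟨T, ⟨hTe, hTne, hTcl⟩, hmin⟩ := exists_min_finset _ hex
      have hTH : T ⊆ H := hTe.trans (Finset.erase_subset _ _)
      have huT : u ∉ T := fun h => by simpa using hTe h
      have hTprop : ∀ S ⊆ T, S ≠ H := fun S hS h => huT (hS (h ▸ hu))
      have hcard : T.card < H.card :=
        Finset.card_lt_card (hTH.ssubset_of_ne (hTprop T subset_rfl))
      have hcT : c ∉ T := fun h => hcH (hTH h)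
      obtain ⟨v, hv, p, hp, hpT, E, hEne, hE, hk⟩ := ih T (insert c D) u (k - 1) (by omega)
        huT
        (by
          rw [Finset.mem_insert, not_or]
          exact ⟨huc.ne, Finset.disjoint_left.1 hHD hu⟩)
        (by
          rw [Finset.disjoint_insert_right]
          exact ⟨hcT, Finset.disjoint_of_subset_left hTH hHD⟩)
        (by
          intro S hS hSne hST
          by_contra hcon
          push Not at hcon
          refine hmin S hS hST ⟨hS.trans hTe, hSne, fun s hs y hy hyS hsy => ?_⟩
          refine hTcl s (hS hs) y hy (fun hyT => ?_) hsy
          exact hcon s hs y hyT hyS hsy)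
        (by
          intro S hS hSne x
          obtain ⟨s, hs, y, h1, h2, h3, h4, h5⟩ := hA S (hS.trans hTH) hSne (hTprop S hS) x
          exact ⟨s, hs, y, h1, by simp [h2, h3], h5, h4⟩)
        (by
          obtain ⟨s, hs, y, hy, hyT, hsy⟩ := hconn T hTH hTne (hTprop T subset_rfl)
          exact ⟨s, hs, hTcl s hs y hy hyT hsy ▸ hsy⟩)
        (by
          intro v hv
          have h1 := hdeg v (hTH hv)
          have h3 : G.neighborFinset v \ insert c D = (G.neighborFinset v \ D).erase c := by
            ext z; simp; tauto
          rw [h3]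
          have := Finset.pred_card_le_card_erase (s := G.neighborFinset v \ D) (a := c)
          omega)
      have hcp : c ∉ p.support := fun h => hcT (hpT c h huc.ne')
      refine ⟨v, hTH hv, p.concat huc, hp.concat hcp huc, ?_, E, hEne, ?_, ?_⟩
      · intro z hz hzc
        rw [SimpleGraph.Walk.support_concat] at hz
        simp only [List.mem_append, List.mem_singleton] at hz
        rcases hz with hz | hz
        · by_cases hzu : z = u
          · exact hzu ▸ hu
          · exact hTH (hpT z hz hzu)
        · exact absurd hz hzc
      · intro e he
        obtain ⟨h1, h2, h3, h4⟩ := hE e he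
        rw [Finset.mem_insert, not_or] at h3
        exact ⟨h1, fun heH => h4 (hTcl v hv e heH h2 h1), h3.2, h3.1⟩
      · rw [SimpleGraph.Walk.length_concat]
        omega


/-- Li–Ning broom lemma: if `G` is 2-connected, `C` is a cycle of `G`, and `H` is a
connected component of `G - V(C)` all of whose vertices have degree at least `k` in `G`,
then `G` contains an `(H,C,t)`-broom with at least `k` edges: a path `P₁` from a vertex
`v₀ ∈ H` to a vertex of `C` whose internal vertices all lie in `H`, together with
`t - 1 ≥ 1` further edges from `v₀` to distinct vertices of `C`, with
`length(P₁) + (t-1) ≥ k` edges in total. -/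
theorem broom_lemma {V : Type*} [Fintype V] [DecidableEq V]
    (G : SimpleGraph V) [DecidableRel G.Adj]
    (h2 : TwoConnected G)
    (w : V) (C : G.Walk w w) (hC : C.IsCycle)
    (H : Set V)
    (hHne : H.Nonempty)
    (hHdisj : ∀ x ∈ H, x ∉ C.support)
    (hHconn : (G.induce H).Connected)
    (hHmax : ∀ x ∈ H, ∀ y : V, G.Adj x y → y ∉ C.support → y ∈ H)
    (k : ℕ) (hdeg : ∀ v ∈ H, k ≤ G.degree v) :
    ∃ (t : ℕ) (ht : 2 ≤ t),
      ∃ (v₀ : V) (_ : v₀ ∈ H) (ends : Fin t ↪ V),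
        (∀ i : Fin t, ends i ∈ C.support) ∧
        (∃ p : G.Walk v₀ (ends ⟨0, by omega⟩), p.IsPath ∧
          (∀ x ∈ p.support, x ≠ ends ⟨0, by omega⟩ → x ∈ H) ∧
          (∀ i : Fin t, i ≠ ⟨0, by omega⟩ → G.Adj v₀ (ends i)) ∧
          k ≤ p.length + (t - 1)) := by
  classical
  obtain ⟨_, hGc, hdel⟩ := h2
  -- a vertex of the cycle different from a given vertex
  have hCx : ∀ x : V, ∃ z ∈ C.support, z ≠ x := by
    intro x
    by_cases hxw : w = x
    · refine ⟨C.snd, C.getVert_mem_support 1, ?_⟩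
      subst hxw
      exact (C.adj_snd hC.not_nil).ne'
    · exact ⟨w, C.start_mem_support, hxw⟩
  have hcut0 : ∀ S ⊆ H.toFinset, S.Nonempty → ∀ x, x ∉ S →
      ∃ s ∈ S, ∃ y, y ∉ S ∧ y ≠ x ∧ G.Adj s y := by
    intro S hS ⟨a, ha⟩ x hx
    obtain ⟨z, hz, hzx⟩ := hCx x
    have hzS : z ∉ S := fun h => hHdisj z (by simpa using hS h) hz
    have hax : a ≠ x := fun h => hx (h ▸ ha)
    obtain ⟨s, hs, y, hy, hsy⟩ := cut_of_connected (hdel x) {q | (q : V) ∈ S}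
      ⟨a, by simpa using hax⟩ ⟨z, by simpa using hzx⟩ ha hzS
    refine ⟨s, hs, y, hy, ?_, ?_⟩
    · have := y.2
      simpa using this
    · exact ((⊤ : G.Subgraph).deleteVerts {x}).adj_sub hsy
  have hcut : ∀ S ⊆ H.toFinset, S.Nonempty → ∀ x,
      ∃ s ∈ S, ∃ y, y ∉ S ∧ y ∉ (∅ : Finset V) ∧ y ≠ x ∧ G.Adj s y := by
    intro S hS hne x
    by_cases hx : x ∈ S
    · have hwS : w ∉ S := fun h => hHdisj w (by simpa using hS h) C.start_mem_support
      obtain ⟨s, hs, y, hy, _, hsy⟩ := hcut0 S hS hne w hwS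
      exact ⟨s, hs, y, hy, by simp, fun h => hy (h ▸ hx), hsy⟩
    · obtain ⟨s, hs, y, hy, hyx, hsy⟩ := hcut0 S hS hne x hx
      exact ⟨s, hs, y, hy, by simp, hyx, hsy⟩
  have hmem : ∀ x, x ∈ H.toFinset ↔ x ∈ H := fun x => by simp
  obtain ⟨u, hu, c, hcH, -, -, huc⟩ := hcut H.toFinset subset_rfl (by simpa using hHne) w
  obtain ⟨v, hv, p, hp, hpH, E, ⟨e₀, he₀⟩, hE, hk⟩ := broom_key G _ H.toFinset ∅ c k le_rfl hcH
    (by simp) (by simp)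
    (by
      intro S hS ⟨a, ha⟩ hne
      obtain ⟨b, hb, hbS⟩ : ∃ b ∈ H.toFinset, b ∉ S := by
        by_contra hcon
        push Not at hcon
        exact hne (Finset.Subset.antisymm hS hcon)
      obtain ⟨s, hs, y, hy, hsy⟩ := cut_of_connected hHconn {q | (q : V) ∈ S}
        ⟨a, (hmem a).1 (hS ha)⟩ ⟨b, (hmem b).1 hb⟩ ha hbS
      exact ⟨s, hs, y, (hmem _).2 y.2, hy, hsy⟩)
    hcut ⟨u, hu, huc⟩
    (by
      intro v hv
      have := hdeg v ((hmem v).1 hv)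
      simpa using this)
  have hout : ∀ a ∈ H, ∀ b, G.Adj a b → b ∉ H → b ∈ C.support := fun a ha b hab hb => by
    by_contra h
    exact hb (hHmax a ha b hab h)
  have hv' := (hmem v).1 hv
  have hinj : Function.Injective
      (Fin.cons c (fun i => ((E.equivFin.symm i : E) : V)) : Fin (E.card + 1) → V) := by
    rw [Fin.cons_injective_iff]
    refine ⟨?_, Subtype.val_injective.comp E.equivFin.symm.injective⟩
    rintro ⟨i, hi⟩
    exact (hE _ (E.equivFin.symm i).2).2.2.2 hi
  have hpos : 0 < E.card := Finset.card_pos.2 ⟨e₀, he₀⟩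
  obtain ⟨ends, h0, hs⟩ : ∃ ends : Fin (E.card + 1) ↪ V, ends ⟨0, Nat.succ_pos _⟩ = c ∧
      ∀ i, i ≠ ⟨0, Nat.succ_pos _⟩ → ends i ∈ E := by
    refine ⟨⟨_, hinj⟩, rfl, fun i => ?_⟩
    induction i using Fin.cases with
    | zero => intro h; exact absurd rfl h
    | succ i =>
      intro _
      exact (E.equivFin.symm i).2
  clear hinj
  subst h0
  refine ⟨E.card + 1, by omega, v, hv', ends, ?_, p, hp, ?_, ?_, ?_⟩
  · intro i
    by_cases hi : i = ⟨0, Nat.succ_pos _⟩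
    · subst hi
      exact hout u ((hmem u).1 hu) _ huc (fun h => hcH ((hmem _).2 h))
    · have := hE _ (hs i hi)
      exact hout v hv' _ this.1 (fun h => this.2.1 ((hmem _).2 h))
  · intro x hx hne
    exact (hmem x).1 (hpH x hx hne)
  · intro i hi
    exact (hE _ (hs i hi)).1
  · simpa using hk
end
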